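/- arXiv:2210.16733 — 5 statements merged into one kernel-verified Lean document; each statement's English description precedes it below -/
import Mathlib

section
/- Let d ≥ 1, p₀ ≥ 1, and p ∈ [1, ∞], and let p̃ ∈ [1, p₀/(p₀−1)] be defined by 1/p̃ = 1 − 1/(p₀p). Then for all non-negative sequences a ∈ ℓ^p(ℤ^d₀), b ∈ ℓ^{p̃}(ℤ^d₀) and c ∈ ℓ^{p₀}(ℤ^d₀) (extended by 0 at the index 0 ∈ ℤ^d), one has ∑_{k ∈ ℤ^d₀} a_k (∑_{j ∈ ℤ^d₀} b_j c_{k−j})^{p₀} ≤ ‖a‖_{ℓ^p} ‖b‖_{ℓ^{p̃}}^{p₀} ‖c‖_{ℓ^{p₀}}^{p₀}. -/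
open scoped ENNReal

/-- The `ℓ^p` norm (with `p ∈ [1,∞]` an extended real) of a nonnegative sequence
indexed by `ℤ^d`, with values in `ℝ≥0∞`. -/
noncomputable def lpNorm {d : ℕ} (p : ℝ≥0∞) (a : (Fin d → ℤ) → ℝ≥0∞) : ℝ≥0∞ :=
  if p = ∞ then ⨆ k, a k else (∑' k, a k ^ p.toReal) ^ (1 / p.toReal)

/-- Hölder's inequality for sums, with weights `s + t = 1` that are allowed to vanish. -/
theorem tsum_rpow_mul_rpow_le {ι : Type*} {s t : ℝ} (hs : 0 ≤ s) (ht : 0 ≤ t) (hst : s + t = 1)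
    (f g : ι → ℝ≥0∞) :
    ∑' i, f i ^ s * g i ^ t ≤ (∑' i, f i) ^ s * (∑' i, g i) ^ t := by
  let _ : MeasurableSpace ι := ⊤
  simpa [MeasureTheory.lintegral_count] using
    ENNReal.lintegral_mul_norm_pow_le (μ := MeasureTheory.Measure.count)
      (f := f) (g := g) measurable_from_top.aemeasurable measurable_from_top.aemeasurable hs ht hst

theorem tsum_mul_rpow_le {ι : Type*} {p q e : ℝ} (hp : 1 ≤ p) (hq : 0 ≤ q) (he : 0 ≤ e)
    (hpqe : q * (p - 1) + e = p) (f g : ι → ℝ≥0∞) :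
    (∑' i, f i * g i) ^ p ≤ (∑' i, f i ^ q) ^ (p - 1) * ∑' i, f i ^ e * g i ^ p := by
  have hp0 : 0 < p := by linarith
  have hs : 0 ≤ (p - 1) / p := div_nonneg (by linarith) hp0.le
  have hsplit (i : ι) :
      f i * g i = (f i ^ q) ^ ((p - 1) / p) * (f i ^ e * g i ^ p) ^ (1 / p) := by
    rw [ENNReal.mul_rpow_of_nonneg _ _ (by positivity), ← ENNReal.rpow_mul, ← ENNReal.rpow_mul,
      ← ENNReal.rpow_mul, ← mul_assoc,
      ← ENNReal.rpow_add_of_nonneg _ _ (mul_nonneg hq hs) (by positivity),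
      mul_one_div_cancel hp0.ne', ENNReal.rpow_one]
    have : q * ((p - 1) / p) + e * (1 / p) = 1 := by
      field_simp
      linarith
    rw [this, ENNReal.rpow_one]
  have h := tsum_rpow_mul_rpow_le hs (by positivity : 0 ≤ 1 / p) (by field_simp; ring)
    (fun i => f i ^ q) (fun i => f i ^ e * g i ^ p)
  simp_rw [← hsplit] at h
  refine (ENNReal.rpow_le_rpow h hp0.le).trans_eq ?_
  rw [ENNReal.mul_rpow_of_nonneg _ _ hp0.le, ← ENNReal.rpow_mul, ← ENNReal.rpow_mul,
    div_mul_cancel₀ _ hp0.ne', one_div_mul_cancel hp0.ne', ENNReal.rpow_one]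

theorem tsum_mul_tsum_mul_sub {G : Type*} [AddCommGroup G] (a f g : G → ℝ≥0∞) :
    ∑' k, a k * ∑' j, f j * g (k - j) = ∑' m, g m * ∑' j, f j * a (j + m) := by
  simp_rw [← ENNReal.tsum_mul_left]
  rw [ENNReal.tsum_comm, ENNReal.tsum_comm (f := fun m j => g m * (f j * a (j + m)))]
  refine tsum_congr fun j => ?_
  rw [← (Equiv.addLeft j).tsum_eq]
  refine tsum_congr fun m => ?_
  simp only [Equiv.coe_addLeft, add_sub_cancel_left]
  ring

theorem tsum_mul_convolution_rpow_le {G : Type*} [AddCommGroup G] {p q e : ℝ} (hp : 1 ≤ p)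
    (hq : 0 ≤ q) (he : 0 ≤ e) (hpqe : q * (p - 1) + e = p) (a b c : G → ℝ≥0∞) {S : ℝ≥0∞}
    (hS : ∀ m, ∑' j, b j ^ e * a (j + m) ≤ S) :
    ∑' k, a k * (∑' j, b j * c (k - j)) ^ p ≤
      (∑' j, b j ^ q) ^ (p - 1) * S * ∑' m, c m ^ p := by
  calc ∑' k, a k * (∑' j, b j * c (k - j)) ^ p
      ≤ ∑' k, a k * ((∑' j, b j ^ q) ^ (p - 1) * ∑' j, b j ^ e * c (k - j) ^ p) := by
        gcongr with k
        exact tsum_mul_rpow_le hp hq he hpqe b fun j => c (k - j)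
    _ = (∑' j, b j ^ q) ^ (p - 1) * ∑' m, c m ^ p * ∑' j, b j ^ e * a (j + m) := by
        rw [← tsum_mul_tsum_mul_sub a (fun j => b j ^ e) (fun m => c m ^ p),
          ← ENNReal.tsum_mul_left]
        exact tsum_congr fun k => mul_left_comm _ _ _
    _ ≤ (∑' j, b j ^ q) ^ (p - 1) * ∑' m, c m ^ p * S := by
        gcongr with m
        exact hS m
    _ = _ := by rw [ENNReal.tsum_mul_right]; ring

theorem lpNorm_ofReal_rpow {d : ℕ} {p : ℝ} (hp : 0 < p) (a : (Fin d → ℤ) → ℝ≥0∞) :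
    lpNorm (ENNReal.ofReal p) a ^ p = ∑' k, a k ^ p := by
  rw [lpNorm, if_neg ENNReal.ofReal_ne_top, ENNReal.toReal_ofReal hp.le, ← ENNReal.rpow_mul,
    one_div_mul_cancel hp.ne', ENNReal.rpow_one]

theorem le_lpNorm_top {d : ℕ} (a : (Fin d → ℤ) → ℝ≥0∞) (k : Fin d → ℤ) : a k ≤ lpNorm ∞ a := by
  rw [lpNorm, if_pos rfl]
  exact le_iSup a k

/-- Young-type convolution inequality
`∑_k a_k (∑_j b_j c_{k-j})^{p₀} ≤ ‖a‖_{ℓ^p} ‖b‖_{ℓ^{p̃}}^{p₀} ‖c‖_{ℓ^{p₀}}^{p₀}`,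
where `1/p̃ = 1 - 1/(p₀ p)`.  Sequences are extended by `0` at the index `0 ∈ ℤ^d`. -/
theorem stmt0 {d : ℕ} (hd : 1 ≤ d) (p₀ : ℝ) (hp₀ : 1 ≤ p₀)
    (p ptilde : ℝ≥0∞) (hp : 1 ≤ p)
    (hptilde : 1 / ptilde = 1 - 1 / (ENNReal.ofReal p₀ * p))
    (a b c : (Fin d → ℤ) → ℝ≥0∞)
    (ha0 : a 0 = 0) (hb0 : b 0 = 0) (hc0 : c 0 = 0)
    (ha : lpNorm p a ≠ ∞) (hb : lpNorm ptilde b ≠ ∞)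
    (hc : lpNorm (ENNReal.ofReal p₀) c ≠ ∞) :
    ∑' k, a k * (∑' j, b j * c (k - j)) ^ p₀ ≤
      lpNorm p a * lpNorm ptilde b ^ p₀ * lpNorm (ENNReal.ofReal p₀) c ^ p₀ := by
  have hp₀' : 0 < p₀ := by linarith
  rw [lpNorm_ofReal_rpow hp₀']
  rcases eq_or_ne p ∞ with rfl | hp_top
  · have hq : ptilde = ENNReal.ofReal 1 := by
      rw [ENNReal.mul_top (by simpa using hp₀'), ENNReal.div_top, tsub_zero, one_div,
        ENNReal.inv_eq_one] at hptilde
      simpa using hptilde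
    subst hq
    have hB := lpNorm_ofReal_rpow one_pos b
    rw [ENNReal.rpow_one] at hB
    rw [hB]
    refine (tsum_mul_convolution_rpow_le (q := 1) (e := 1) (S := (∑' j, b j ^ (1 : ℝ)) * lpNorm ∞ a)
      hp₀ zero_le_one zero_le_one (by ring) a b c fun m => ?_).trans_eq ?_
    · rw [← ENNReal.tsum_mul_right]
      gcongr
      exact le_lpNorm_top a _
    · have hpow (x : ℝ≥0∞) : x ^ (p₀ - 1) * x = x ^ p₀ := by
        nth_rw 2 [← ENNReal.rpow_one x]
        rw [← ENNReal.rpow_add_of_nonneg _ _ (by linarith) zero_le_one, sub_add_cancel]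
      rw [← mul_assoc, hpow, mul_comm (_ ^ p₀) (lpNorm ∞ a)]
  obtain ⟨P, hP, rfl⟩ : ∃ P : ℝ, 1 ≤ P ∧ p = ENNReal.ofReal P :=
    ⟨p.toReal, by simpa using ENNReal.toReal_mono hp_top hp, (ENNReal.ofReal_toReal hp_top).symm⟩
  have hP' : 0 < P := by linarith
  have hprod : 1 ≤ p₀ * P := one_le_mul_of_one_le_of_one_le hp₀ hP
  rw [← ENNReal.ofReal_mul hp₀'.le, ← ENNReal.ofReal_one,
    ← ENNReal.ofReal_div_of_pos (by positivity),
    ← ENNReal.ofReal_sub _ (by positivity)] at hptilde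
  rcases hprod.eq_or_lt with h1 | h1
  · have hp₀1 : p₀ = 1 := by nlinarith
    have hP1 : P = 1 := by nlinarith
    subst hp₀1 hP1
    have hq : ptilde = ∞ := by simpa using hptilde
    subst hq
    have hA := lpNorm_ofReal_rpow one_pos a
    rw [ENNReal.rpow_one] at hA
    rw [hA]
    refine (tsum_mul_convolution_rpow_le (q := 0) (e := 1)
      (S := lpNorm ∞ b * ∑' j, a j ^ (1 : ℝ)) le_rfl le_rfl zero_le_one (by ring)
      a b c fun m => ?_).trans_eq ?_
    · simp only [ENNReal.rpow_one]
      rw [← (Equiv.addRight m).tsum_eq a, ← ENNReal.tsum_mul_left]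
      exact ENNReal.tsum_le_tsum fun j => mul_le_mul_left (le_lpNorm_top b j) _
    · rw [sub_self, ENNReal.rpow_zero, one_mul, ENNReal.rpow_one, mul_comm (lpNorm ∞ b)]
  have hpos : 0 < p₀ * P - 1 := by linarith
  obtain ⟨Q, hQdef⟩ : ∃ Q, Q = p₀ * P / (p₀ * P - 1) := ⟨_, rfl⟩
  have hQ : 0 < Q := by rw [hQdef]; positivity
  have hq : ptilde = ENNReal.ofReal Q := by
    have h : 1 - 1 / (p₀ * P) = Q⁻¹ := by
      rw [hQdef]
      field_simp
    rw [h, ENNReal.ofReal_inv_of_pos hQ, ENNReal.ofReal_one, one_div, inv_inj] at hptilde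
    exact hptilde
  subst hq
  have ht : 0 ≤ 1 - 1 / P := by
    rw [sub_nonneg, div_le_one hP']
    exact hP
  refine (tsum_mul_convolution_rpow_le (q := Q) (e := Q * (1 - 1 / P))
    (S := (∑' j, b j ^ Q) ^ (1 - 1 / P) * lpNorm (ENNReal.ofReal P) a) hp₀ hQ.le
    (mul_nonneg hQ.le ht) ?_ a b c fun m => ?_).trans_eq ?_
  · rw [hQdef]
    field_simp
    ring
  · have h := tsum_rpow_mul_rpow_le ht (by positivity : 0 ≤ 1 / P) (by ring)
      (fun j => b j ^ Q) (fun j => a (j + m) ^ P)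
    simp only [← ENNReal.rpow_mul, mul_one_div_cancel hP'.ne', ENNReal.rpow_one] at h
    rw [lpNorm, if_neg ENNReal.ofReal_ne_top, ENNReal.toReal_ofReal hP'.le,
      ← (Equiv.addRight m).tsum_eq (fun j => a j ^ P)]
    exact h
  · have hB : lpNorm (ENNReal.ofReal Q) b ^ p₀ =
        (∑' j, b j ^ Q) ^ (p₀ - 1) * (∑' j, b j ^ Q) ^ (1 - 1 / P) := by
      rw [lpNorm, if_neg ENNReal.ofReal_ne_top, ENNReal.toReal_ofReal hQ.le, ← ENNReal.rpow_mul,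
        ← ENNReal.rpow_add_of_nonneg _ _ (by linarith) ht]
      congr 1
      rw [hQdef]
      field_simp
      ring
    rw [hB]
    ring
end

section
/- Let d ≥ 1, s ≥ 0 and p₀ ≥ 1. Assume p₁ ∈ [1, ∞] and p₂ ∈ [1, p₀/(p₀−1)] satisfy: 0 ≤ 1 − 1/(p₀p₁) − 1/p₂ < s/d if s > 0, and 1/(p₀p₁) + 1/p₂ = 1 if s = 0. Let A, B, C be non-negative sequences indexed by ℤ^d₀ (extended by 0 at the index 0), and assume that the sequences A^{(s)} := (|k|^{p₀ s} A_k)_k lies in ℓ^{p₁}(ℤ^d₀), B^{(s)} := (|k|^{s} B_k)_k lies in ℓ^{p₂}(ℤ^d₀), and C^{(s)} := (|k|^{−s} C_k)_k lies in ℓ^{p₀}(ℤ^d₀). Then there is a constant C' > 0, depending only on d, s, p₀, p₁, p₂, such that ∑_{k ∈ ℤ^d₀} A_k (∑_{j ∈ ℤ^d₀} B_j C_{k−j})^{p₀} ≤ C' ‖A^{(s)}‖_{ℓ^{p₁}} ‖B^{(s)}‖_{ℓ^{p₂}}^{p₀} ‖C^{(s)}‖_{ℓ^{p₀}}^{p₀}.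 -/
open scoped ENNReal

/-- Euclidean norm of a lattice point `k ∈ ℤ^d`. -/
noncomputable def znorm {d : ℕ} (k : Fin d → ℤ) : ℝ :=
  Real.sqrt (∑ i, ((k i : ℝ)) ^ 2)

/-- The `ℓ^{1/x}` norm of a family `a`, parametrized by the reciprocal exponent `x`; the
supremum when `x = 0`. -/
noncomputable def recipNorm {ι : Type*} (x : ℝ) (a : ι → ℝ≥0∞) : ℝ≥0∞ :=
  if x = 0 then ⨆ k, a k else (∑' k, a k ^ (1 / x)) ^ x

section recipNorm

variable {ι : Type*}

lemma recipNorm_zero (a : ι → ℝ≥0∞) : recipNorm 0 a = ⨆ k, a k := by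
  simp [recipNorm]

lemma recipNorm_of_pos {x : ℝ} (hx : 0 < x) (a : ι → ℝ≥0∞) :
    recipNorm x a = (∑' k, a k ^ (1 / x)) ^ x := by
  simp [recipNorm, hx.ne']

lemma recipNorm_one (a : ι → ℝ≥0∞) : recipNorm 1 a = ∑' k, a k := by
  simp [recipNorm]

lemma recipNorm_comp_equiv (x : ℝ) (a : ι → ℝ≥0∞) (e : ι ≃ ι) :
    recipNorm x (fun k => a (e k)) = recipNorm x a := by
  unfold recipNorm
  rw [e.iSup_comp (g := a), e.tsum_eq (fun k => a k ^ (1 / x))]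

lemma lpNorm_eq_recipNorm {d : ℕ} {p : ℝ≥0∞} (hp : 1 ≤ p) (a : (Fin d → ℤ) → ℝ≥0∞) :
    lpNorm p a = recipNorm p⁻¹.toReal a := by
  rcases eq_or_ne p ∞ with rfl | h
  · simp [lpNorm, recipNorm]
  · have h0 : 0 < p.toReal := ENNReal.toReal_pos (by positivity) h
    rw [ENNReal.toReal_inv, recipNorm_of_pos (inv_pos.2 h0), lpNorm, if_neg h]
    simp

lemma recipNorm_mul_le_zero_mul {y : ℝ} (hy : 0 ≤ y) (a b : ι → ℝ≥0∞) :
    recipNorm y (fun k => a k * b k) ≤ recipNorm 0 a * recipNorm y b := by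
  rw [recipNorm_zero]
  rcases hy.eq_or_lt with rfl | hy
  · rw [recipNorm_zero, recipNorm_zero]
    exact iSup_le fun k => mul_le_mul' (le_iSup a k) (le_iSup b k)
  · rw [recipNorm_of_pos hy, recipNorm_of_pos hy]
    calc (∑' k, (a k * b k) ^ (1 / y)) ^ y
        ≤ (∑' k, (⨆ k, a k) ^ (1 / y) * b k ^ (1 / y)) ^ y := by
          gcongr with k
          rw [ENNReal.mul_rpow_of_nonneg _ _ (by positivity)]
          gcongr
          exact le_iSup a k
      _ = (⨆ k, a k) * (∑' k, b k ^ (1 / y)) ^ y := by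
          rw [ENNReal.tsum_mul_left, ENNReal.mul_rpow_of_nonneg _ _ hy.le, ← ENNReal.rpow_mul,
            one_div_mul_cancel hy.ne', ENNReal.rpow_one]

/-- The Hölder inequality. -/
lemma recipNorm_mul_le {x y : ℝ} (hx : 0 ≤ x) (hy : 0 ≤ y) (a b : ι → ℝ≥0∞) :
    recipNorm (x + y) (fun k => a k * b k) ≤ recipNorm x a * recipNorm y b := by
  rcases hx.eq_or_lt with rfl | hx
  · rw [zero_add]
    exact recipNorm_mul_le_zero_mul hy a b
  rcases hy.eq_or_lt with rfl | hy
  · rw [add_zero]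
    simpa only [mul_comm] using recipNorm_mul_le_zero_mul hx.le b a
  let _ : MeasurableSpace ι := ⊤
  have key := ENNReal.lintegral_Lp_mul_le_Lq_mul_Lr (p := 1 / (x + y)) (q := 1 / x) (r := 1 / y)
    (by positivity) (one_div_lt_one_div_of_lt hx (by linarith)) (by simp)
    (MeasureTheory.Measure.count) (f := a) (g := b) measurable_from_top.aemeasurable
    measurable_from_top.aemeasurable
  rw [recipNorm_of_pos (add_pos hx hy), recipNorm_of_pos hx, recipNorm_of_pos hy]
  simpa [MeasureTheory.lintegral_count' measurable_from_top] using key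

lemma recipNorm_rpow_le [Nonempty ι] {x r : ℝ} (hx : 0 ≤ x) (hr : 0 ≤ r) (a : ι → ℝ≥0∞) :
    recipNorm (x * r) (fun k => a k ^ r) ≤ recipNorm x a ^ r := by
  rcases hr.eq_or_lt with rfl | hr
  · simp [recipNorm]
  rcases hx.eq_or_lt with rfl | hx
  · rw [zero_mul, recipNorm_zero, recipNorm_zero]
    exact iSup_le fun k => ENNReal.rpow_le_rpow (le_iSup a k) hr.le
  · rw [recipNorm_of_pos (mul_pos hx hr), recipNorm_of_pos hx, ← ENNReal.rpow_mul]
    simp_rw [← ENNReal.rpow_mul]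
    rw [show r * (1 / (x * r)) = 1 / x by field_simp]

/-- A weighted Young inequality: multiplying the `p₀`-th power of a convolution of
`β ∈ ℓ^{1/v}` and `c ∈ ℓ^{p₀}` by `a ∈ ℓ^{1/u}` yields a summable family. -/
lemma tsum_mul_convolution_rpow_le_s1 {G : Type*} [AddCommGroup G] {p₀ u v : ℝ} (hp₀ : 1 ≤ p₀)
    (hu : 0 ≤ u) (hu1 : u ≤ 1) (hv : v = 1 - u / p₀) (a β c : G → ℝ≥0∞) :
    ∑' k, a k * (∑' j, β j * c (k - j)) ^ p₀ ≤
      recipNorm u a * recipNorm v β ^ p₀ * ∑' m, c m ^ p₀ := by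
  have hp : 0 < p₀ := by linarith
  have hv1 : 1 - 1 / p₀ ≤ v := by
    rw [hv]
    gcongr
  have hp1 : 0 ≤ 1 - 1 / p₀ := by
    rw [sub_nonneg, div_le_one hp]
    exact hp₀
  have hv0 : 0 ≤ v := hp1.trans hv1
  obtain ⟨y, hy0, hy1, hy⟩ : ∃ y : ℝ, 0 ≤ y ∧ y ≤ 1 ∧ v * (1 - y) = 1 - 1 / p₀ := by
    rcases hv0.eq_or_lt with h | h
    · exact ⟨1, by simp, le_rfl, by rw [← h] at hv1 ⊢; linarith⟩
    · refine ⟨1 - (1 - 1 / p₀) / v, ?_, ?_, ?_⟩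
      · rw [sub_nonneg, div_le_one h]
        exact hv1
      · have := div_nonneg hp1 h.le
        linarith
      · field_simp
        ring
  have hy' : v * (y * p₀) = 1 - u := by
    have h1 : v * (1 - y) * p₀ = p₀ - 1 := by rw [hy]; field_simp
    have h2 : v * p₀ = p₀ - u := by rw [hv]; field_simp
    linarith
  have hconv (k : G) : (∑' j, β j * c (k - j)) ^ p₀ ≤
      (∑' j, β j ^ (y * p₀) * c (k - j) ^ p₀) * recipNorm v β ^ ((1 - y) * p₀) := by
    have h1 : ∑' j, β j * c (k - j) ≤
        recipNorm (1 / p₀) (fun j => β j ^ y * c (k - j)) * recipNorm v β ^ (1 - y) := by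
      calc ∑' j, β j * c (k - j)
          = recipNorm (1 / p₀ + (1 - 1 / p₀))
              (fun j => β j ^ y * c (k - j) * β j ^ (1 - y)) := by
            rw [add_sub_cancel, recipNorm_one]
            congr 1 with j
            rw [mul_right_comm, ← ENNReal.rpow_add_of_nonneg _ _ hy0 (by linarith),
              add_sub_cancel, ENNReal.rpow_one]
        _ ≤ _ := recipNorm_mul_le (by positivity) hp1 _ _
        _ ≤ _ := by
            gcongr
            rw [← hy]
            exact recipNorm_rpow_le hv0 (by linarith) β
    calc (∑' j, β j * c (k - j)) ^ p₀
        ≤ (recipNorm (1 / p₀) (fun j => β j ^ y * c (k - j)) * recipNorm v β ^ (1 - y)) ^ p₀ := by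
          gcongr
      _ = _ := by
          rw [ENNReal.mul_rpow_of_nonneg _ _ hp.le, recipNorm_of_pos (by positivity),
            ← ENNReal.rpow_mul, ← ENNReal.rpow_mul, one_div_mul_cancel hp.ne', ENNReal.rpow_one]
          simp_rw [one_div_one_div, ENNReal.mul_rpow_of_nonneg _ _ hp.le, ← ENNReal.rpow_mul]
  have hshift (m : G) : ∑' k, a k * β (k - m) ^ (y * p₀) ≤
      recipNorm u a * recipNorm v β ^ (y * p₀) := by
    calc ∑' k, a k * β (k - m) ^ (y * p₀)
        = recipNorm (u + (1 - u)) (fun k => a k * β (k - m) ^ (y * p₀)) := by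
          rw [add_sub_cancel, recipNorm_one]
      _ ≤ recipNorm u a * recipNorm (1 - u) (fun k => β (k - m) ^ (y * p₀)) :=
          recipNorm_mul_le hu (by linarith) _ _
      _ ≤ recipNorm u a * recipNorm v (fun k => β (k - m)) ^ (y * p₀) := by
          gcongr
          rw [← hy']
          exact recipNorm_rpow_le hv0 (by positivity) _
      _ = _ := by
          rw [← recipNorm_comp_equiv v β (Equiv.subRight m)]
          rfl
  calc ∑' k, a k * (∑' j, β j * c (k - j)) ^ p₀
      ≤ ∑' k, a k * ((∑' j, β j ^ (y * p₀) * c (k - j) ^ p₀) *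
          recipNorm v β ^ ((1 - y) * p₀)) := by
        gcongr with k
        exact hconv k
    _ = (∑' k, ∑' m, c m ^ p₀ * (a k * β (k - m) ^ (y * p₀))) *
          recipNorm v β ^ ((1 - y) * p₀) := by
        rw [← ENNReal.tsum_mul_right]
        congr 1 with k
        rw [← mul_assoc, ← ENNReal.tsum_mul_left, ← (Equiv.subLeft k).tsum_eq]
        congr 2 with m
        simp only [Equiv.subLeft_apply, sub_sub_cancel]
        ring
    _ = (∑' m, c m ^ p₀ * ∑' k, a k * β (k - m) ^ (y * p₀)) *
          recipNorm v β ^ ((1 - y) * p₀) := by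
        rw [ENNReal.tsum_comm]
        simp_rw [ENNReal.tsum_mul_left]
    _ ≤ (∑' m, c m ^ p₀ * (recipNorm u a * recipNorm v β ^ (y * p₀))) *
          recipNorm v β ^ ((1 - y) * p₀) := by
        gcongr with m
        exact hshift m
    _ = recipNorm u a * (recipNorm v β ^ (y * p₀) * recipNorm v β ^ ((1 - y) * p₀)) *
          ∑' m, c m ^ p₀ := by
        rw [ENNReal.tsum_mul_right]
        ring
    _ = _ := by
        rw [← ENNReal.rpow_add_of_nonneg _ _ (by positivity)
          (mul_nonneg (by linarith) hp.le)]
        congr 3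
        ring

end recipNorm

section znorm

variable {d : ℕ}

lemma znorm_eq_norm (k : Fin d → ℤ) :
    znorm k = ‖(WithLp.toLp 2 (fun i => (k i : ℝ)) : EuclideanSpace ℝ (Fin d))‖ := by
  simp [znorm, EuclideanSpace.norm_eq]

lemma znorm_zero : znorm (0 : Fin d → ℤ) = 0 := by
  simp [znorm]

lemma one_le_znorm {k : Fin d → ℤ} (hk : k ≠ 0) : 1 ≤ znorm k := by
  obtain ⟨i, hi⟩ := Function.ne_iff.1 hk
  rw [znorm, Real.one_le_sqrt]
  calc (1 : ℝ) ≤ (k i : ℝ) ^ 2 := by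
        have : 1 ≤ k i ^ 2 := Int.one_le_abs hi |>.trans (Int.le_self_sq _) |>.trans (sq_abs _).le
        exact_mod_cast this
    _ ≤ _ := Finset.single_le_sum (f := fun i => (k i : ℝ) ^ 2) (fun i _ => sq_nonneg _)
        (Finset.mem_univ i)

lemma znorm_sub_le (k j : Fin d → ℤ) : znorm (k - j) ≤ znorm k + znorm j := by
  simp only [znorm_eq_norm]
  convert! norm_sub_le _ _ using 2
  ext i
  simp

lemma summable_znorm_rpow {r : ℝ} (hr : r < -d) :
    Summable fun k : Fin d → ℤ => znorm k ^ r := by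
  let b := (EuclideanSpace.basisFun (Fin d) ℝ).toBasis
  let L := Submodule.span ℤ (Set.range b)
  have hL : Module.finrank ℤ L = d := by
    rw [ZLattice.rank ℝ L]
    simp
  have hmem (k : Fin d → ℤ) :
      (WithLp.toLp 2 (fun i => (k i : ℝ)) : EuclideanSpace ℝ (Fin d)) ∈ L := by
    rw [b.mem_span_iff_repr_mem ℤ]
    intro i
    exact ⟨k i, by simp [b]⟩
  have h := ZLattice.summable_norm_rpow L r (by rw [hL]; exact hr)
  have := h.comp_injective (i := fun k : Fin d → ℤ => (⟨_, hmem k⟩ : L)) (by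
    intro k l hkl
    ext i
    have := congrArg (fun z : L => (z : EuclideanSpace ℝ (Fin d)) i) hkl
    simpa using this)
  refine this.congr fun k => ?_
  simp [znorm_eq_norm]

lemma recipNorm_znorm_lt_top {s δ : ℝ} (hs : 0 ≤ s) (hδ : 0 ≤ δ) (h : 0 < δ → δ * d < s) :
    recipNorm δ (fun k : Fin d → ℤ => ENNReal.ofReal (znorm k ^ (-s))) < ∞ := by
  rcases hδ.eq_or_lt with rfl | hδ
  · rw [recipNorm_zero]
    refine lt_of_le_of_lt (iSup_le fun k => ?_) ENNReal.one_lt_top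
    rw [ENNReal.ofReal_le_one]
    rcases eq_or_ne k 0 with rfl | hk
    · rw [znorm_zero]
      exact Real.zero_rpow_le_one _
    · exact Real.rpow_le_one_of_one_le_of_nonpos (one_le_znorm hk) (by linarith)
  · rw [recipNorm_of_pos hδ]
    refine ENNReal.rpow_lt_top_of_nonneg hδ.le ?_
    have hn (k : Fin d → ℤ) : 0 ≤ znorm k := Real.sqrt_nonneg _
    have hsum : Summable fun k : Fin d → ℤ => znorm k ^ (-s * (1 / δ)) := by
      apply summable_znorm_rpow
      have := h hδ
      rw [mul_one_div, div_lt_iff₀ hδ]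
      linarith
    convert! hsum.tsum_ofReal_ne_top using 3 with k
    rw [ENNReal.ofReal_rpow_of_nonneg (Real.rpow_nonneg (hn k) _) (by positivity),
      ← Real.rpow_mul (hn k)]

lemma znorm_rpow_mul_le {s : ℝ} (hs : 0 ≤ s) {k j : Fin d → ℤ} (hk : k ≠ 0) (hj : j ≠ 0) :
    znorm k ^ (-s) * znorm j ^ (-s) * znorm (k - j) ^ s ≤
      2 ^ s * (znorm j ^ (-s) + znorm k ^ (-s)) := by
  have hk0 : 0 < znorm k := zero_lt_one.trans_le (one_le_znorm hk)
  have hj0 : 0 < znorm j := zero_lt_one.trans_le (one_le_znorm hj)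
  have hkj : 0 ≤ znorm (k - j) := Real.sqrt_nonneg _
  have hmax : znorm (k - j) ^ s ≤ 2 ^ s * (znorm k ^ s + znorm j ^ s) := by
    calc znorm (k - j) ^ s ≤ (2 * max (znorm k) (znorm j)) ^ s := by
          gcongr
          linarith [znorm_sub_le k j, le_max_left (znorm k) (znorm j),
            le_max_right (znorm k) (znorm j)]
      _ = 2 ^ s * max (znorm k) (znorm j) ^ s := Real.mul_rpow (by norm_num) (by positivity)
      _ ≤ _ := by
          gcongr
          rcases max_cases (znorm k) (znorm j) with ⟨h, _⟩ | ⟨h, _⟩ <;> rw [h]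
          · have : 0 ≤ znorm j ^ s := by positivity
            linarith
          · have : 0 ≤ znorm k ^ s := by positivity
            linarith
  have hkk : znorm k ^ (-s) * znorm k ^ s = 1 := by
    rw [← Real.rpow_add hk0, neg_add_cancel, Real.rpow_zero]
  have hjj : znorm j ^ (-s) * znorm j ^ s = 1 := by
    rw [← Real.rpow_add hj0, neg_add_cancel, Real.rpow_zero]
  calc znorm k ^ (-s) * znorm j ^ (-s) * znorm (k - j) ^ s
      ≤ znorm k ^ (-s) * znorm j ^ (-s) * (2 ^ s * (znorm k ^ s + znorm j ^ s)) := by gcongr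
    _ = 2 ^ s * (znorm j ^ (-s) * (znorm k ^ (-s) * znorm k ^ s) +
          znorm k ^ (-s) * (znorm j ^ (-s) * znorm j ^ s)) := by ring
    _ = _ := by rw [hkk, hjj, mul_one, mul_one]

lemma ofReal_znorm_rpow_mul_mul {s : ℝ} {k : Fin d → ℤ} {t : ℝ≥0∞} (h : k = 0 → t = 0) :
    ENNReal.ofReal (znorm k ^ (-s)) * (ENNReal.ofReal (znorm k ^ s) * t) = t := by
  by_cases hk : k = 0
  · simp [h hk]
  · have hk0 : 0 < znorm k := zero_lt_one.trans_le (one_le_znorm hk)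
    rw [← mul_assoc, ← ENNReal.ofReal_mul (by positivity), ← Real.rpow_add hk0, neg_add_cancel,
      Real.rpow_zero, ENNReal.ofReal_one, one_mul]

/-- The weighted convolution inequality in terms of reciprocal exponents. -/
lemma tsum_mul_convolution_rpow_le_of_weight {s p₀ u v δ : ℝ} (hs : 0 ≤ s) (hp₀ : 1 ≤ p₀)
    (hu : 0 ≤ u) (hv : 1 - 1 / p₀ ≤ v) (hδ : 0 ≤ δ) (huv : u / p₀ + v + δ = 1)
    {A B C : (Fin d → ℤ) → ℝ≥0∞} (hA : A 0 = 0) (hB : B 0 = 0) (hC : C 0 = 0) :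
    ∑' k, A k * (∑' j, B j * C (k - j)) ^ p₀ ≤
      ENNReal.ofReal (2 ^ s) ^ p₀ * 2 ^ (p₀ - 1) *
        (2 * recipNorm δ (fun k : Fin d → ℤ => ENNReal.ofReal (znorm k ^ (-s))) ^ p₀) *
        recipNorm u (fun k => ENNReal.ofReal (znorm k ^ (p₀ * s)) * A k) *
        recipNorm v (fun k => ENNReal.ofReal (znorm k ^ s) * B k) ^ p₀ *
        ∑' k, (ENNReal.ofReal (znorm k ^ (-s)) * C k) ^ p₀ := by
  have hp : 0 < p₀ := by linarith
  have hv0 : 0 ≤ v := by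
    refine le_trans ?_ hv
    rw [sub_nonneg, div_le_one hp]
    exact hp₀
  have hup : u = p₀ * (1 - v - δ) := by
    rw [← huv]
    field_simp
    ring
  have hvp : p₀ * (1 - v) ≤ 1 := by
    have := mul_le_mul_of_nonneg_left hv hp.le
    rw [mul_sub, mul_one_div_cancel hp.ne'] at this
    linarith
  set w : (Fin d → ℤ) → ℝ≥0∞ := fun k => ENNReal.ofReal (znorm k ^ (-s)) with hw
  set a : (Fin d → ℤ) → ℝ≥0∞ := fun k => ENNReal.ofReal (znorm k ^ (p₀ * s)) * A k with ha
  set b : (Fin d → ℤ) → ℝ≥0∞ := fun k => ENNReal.ofReal (znorm k ^ s) * B k with hb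
  set c : (Fin d → ℤ) → ℝ≥0∞ := fun k => ENNReal.ofReal (znorm k ^ (-s)) * C k with hc
  have hwp (k : Fin d → ℤ) : w k ^ p₀ = ENNReal.ofReal (znorm k ^ (-(p₀ * s))) := by
    have h0 : 0 ≤ znorm k := Real.sqrt_nonneg _
    rw [hw, ENNReal.ofReal_rpow_of_nonneg (by positivity) hp.le, ← Real.rpow_mul h0]
    congr 2
    ring
  have hAa (k : Fin d → ℤ) : w k ^ p₀ * a k = A k := by
    rw [hwp]
    exact ofReal_znorm_rpow_mul_mul fun h => h ▸ hA
  have hBb (j : Fin d → ℤ) : w j * b j = B j :=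
    ofReal_znorm_rpow_mul_mul fun h => h ▸ hB
  have hCc (m : Fin d → ℤ) : ENNReal.ofReal (znorm m ^ s) * c m = C m := by
    have := ofReal_znorm_rpow_mul_mul (s := -s) (k := m) (t := C m) fun h => h ▸ hC
    rwa [neg_neg] at this
  have hterm (k j : Fin d → ℤ) (hk : k ≠ 0) : w k * (B j * C (k - j)) ≤
      ENNReal.ofReal (2 ^ s) * (w j * b j * c (k - j) + w k * (b j * c (k - j))) := by
    rcases eq_or_ne j 0 with rfl | hj
    · simp [hB]
    have h0 (k : Fin d → ℤ) : 0 ≤ znorm k := Real.sqrt_nonneg _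
    have h0' (k : Fin d → ℤ) (t : ℝ) : 0 ≤ znorm k ^ t := Real.rpow_nonneg (h0 k) t
    have h1 : w k * w j * ENNReal.ofReal (znorm (k - j) ^ s) ≤
        ENNReal.ofReal (2 ^ s) * (w j + w k) := by
      simp only [hw]
      rw [← ENNReal.ofReal_mul (h0' _ _), ← ENNReal.ofReal_mul (mul_nonneg (h0' _ _) (h0' _ _)),
        ← ENNReal.ofReal_add (h0' _ _) (h0' _ _), ← ENNReal.ofReal_mul (by positivity)]
      exact ENNReal.ofReal_le_ofReal (znorm_rpow_mul_le hs hk hj)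
    calc w k * (B j * C (k - j))
        = w k * w j * ENNReal.ofReal (znorm (k - j) ^ s) * (b j * c (k - j)) := by
          rw [← hBb j, ← hCc (k - j)]
          ring
      _ ≤ ENNReal.ofReal (2 ^ s) * (w j + w k) * (b j * c (k - j)) := by gcongr
      _ = _ := by ring
  have hsum (k : Fin d → ℤ) : A k * (∑' j, B j * C (k - j)) ^ p₀ ≤
      ENNReal.ofReal (2 ^ s) ^ p₀ * 2 ^ (p₀ - 1) *
        (a k * (∑' j, w j * b j * c (k - j)) ^ p₀ +
          w k ^ p₀ * a k * (∑' j, b j * c (k - j)) ^ p₀) := by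
    rcases eq_or_ne k 0 with rfl | hk
    · simp [hA]
    calc A k * (∑' j, B j * C (k - j)) ^ p₀
        = a k * (∑' j, w k * (B j * C (k - j))) ^ p₀ := by
          rw [ENNReal.tsum_mul_left, ENNReal.mul_rpow_of_nonneg _ _ hp.le, ← hAa k]
          ring
      _ ≤ a k * (∑' j, ENNReal.ofReal (2 ^ s) *
            (w j * b j * c (k - j) + w k * (b j * c (k - j)))) ^ p₀ := by
          refine mul_le_mul_right (ENNReal.rpow_le_rpow ?_ hp.le) _
          exact ENNReal.tsum_le_tsum fun j => hterm k j hk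
      _ = a k * (ENNReal.ofReal (2 ^ s) ^ p₀ * (∑' j, w j * b j * c (k - j) +
            w k * ∑' j, b j * c (k - j)) ^ p₀) := by
          rw [ENNReal.tsum_mul_left, ENNReal.mul_rpow_of_nonneg _ _ hp.le, ENNReal.tsum_add,
            ENNReal.tsum_mul_left (a := w k)]
      _ ≤ a k * (ENNReal.ofReal (2 ^ s) ^ p₀ * (2 ^ (p₀ - 1) *
            ((∑' j, w j * b j * c (k - j)) ^ p₀ + (w k * ∑' j, b j * c (k - j)) ^ p₀))) := by
          gcongr
          exact ENNReal.rpow_add_le_mul_rpow_add_rpow _ _ hp₀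
      _ = _ := by
          rw [ENNReal.mul_rpow_of_nonneg _ _ hp.le]
          ring
  have hfst : ∑' k, a k * (∑' j, w j * b j * c (k - j)) ^ p₀ ≤
      recipNorm δ w ^ p₀ * (recipNorm u a * recipNorm v b ^ p₀ * ∑' k, c k ^ p₀) := by
    calc _ ≤ recipNorm u a * recipNorm (δ + v) (fun j => w j * b j) ^ p₀ * ∑' k, c k ^ p₀ :=
          tsum_mul_convolution_rpow_le_s1 hp₀ hu
            (by rw [hup]; linarith [mul_nonneg hp.le hδ]) (by linarith) a _ c
      _ ≤ recipNorm u a * (recipNorm δ w * recipNorm v b) ^ p₀ * ∑' k, c k ^ p₀ := by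
          gcongr
          exact recipNorm_mul_le hδ hv0 w b
      _ = _ := by
          rw [ENNReal.mul_rpow_of_nonneg _ _ hp.le]
          ring
  have hsnd : ∑' k, w k ^ p₀ * a k * (∑' j, b j * c (k - j)) ^ p₀ ≤
      recipNorm δ w ^ p₀ * (recipNorm u a * recipNorm v b ^ p₀ * ∑' k, c k ^ p₀) := by
    calc _ ≤ recipNorm (δ * p₀ + u) (fun k => w k ^ p₀ * a k) * recipNorm v b ^ p₀ *
            ∑' k, c k ^ p₀ :=
          tsum_mul_convolution_rpow_le_s1 hp₀ (by positivity) (by rw [hup]; linarith)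
            (by rw [hup]; field_simp; ring) _ b c
      _ ≤ recipNorm (δ * p₀) (fun k => w k ^ p₀) * recipNorm u a * recipNorm v b ^ p₀ *
            ∑' k, c k ^ p₀ := by
          gcongr
          exact recipNorm_mul_le (by positivity) hu _ _
      _ ≤ recipNorm δ w ^ p₀ * recipNorm u a * recipNorm v b ^ p₀ * ∑' k, c k ^ p₀ := by
          gcongr
          exact recipNorm_rpow_le hδ hp.le w
      _ = _ := by ring
  calc ∑' k, A k * (∑' j, B j * C (k - j)) ^ p₀
      ≤ ∑' k, ENNReal.ofReal (2 ^ s) ^ p₀ * 2 ^ (p₀ - 1) *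
          (a k * (∑' j, w j * b j * c (k - j)) ^ p₀ +
            w k ^ p₀ * a k * (∑' j, b j * c (k - j)) ^ p₀) := ENNReal.tsum_le_tsum hsum
    _ = ENNReal.ofReal (2 ^ s) ^ p₀ * 2 ^ (p₀ - 1) *
          (∑' k, a k * (∑' j, w j * b j * c (k - j)) ^ p₀ +
            ∑' k, w k ^ p₀ * a k * (∑' j, b j * c (k - j)) ^ p₀) := by
        rw [ENNReal.tsum_mul_left, ENNReal.tsum_add]
    _ ≤ ENNReal.ofReal (2 ^ s) ^ p₀ * 2 ^ (p₀ - 1) *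
          (recipNorm δ w ^ p₀ * (recipNorm u a * recipNorm v b ^ p₀ * ∑' k, c k ^ p₀) +
            recipNorm δ w ^ p₀ * (recipNorm u a * recipNorm v b ^ p₀ * ∑' k, c k ^ p₀)) := by
        gcongr
    _ = _ := by ring

end znorm

/-- weighted convolution inequality.  With `A^{(s)}_k = |k|^{p₀ s} A_k`,
`B^{(s)}_k = |k|^{s} B_k`, `C^{(s)}_k = |k|^{-s} C_k`, under the exponent conditions
`0 ≤ 1 - 1/(p₀p₁) - 1/p₂ < s/d` (for `s > 0`), resp. `1/(p₀p₁) + 1/p₂ = 1` (for `s = 0`),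
one has `∑_k A_k (∑_j B_j C_{k-j})^{p₀} ≲ ‖A^{(s)}‖_{ℓ^{p₁}} ‖B^{(s)}‖_{ℓ^{p₂}}^{p₀}
‖C^{(s)}‖_{ℓ^{p₀}}^{p₀}`. -/
theorem stmt1 {d : ℕ} (hd : 1 ≤ d) (s p₀ : ℝ) (hs : 0 ≤ s) (hp₀ : 1 ≤ p₀)
    (p₁ p₂ : ℝ≥0∞) (hp₁ : 1 ≤ p₁) (hp₂ : 1 ≤ p₂)
    (hp₂' : p₂ ≤ ENNReal.ofReal p₀ / (ENNReal.ofReal p₀ - 1))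
    (hle : 1 / (ENNReal.ofReal p₀ * p₁) + 1 / p₂ ≤ 1)
    (heq : s = 0 → 1 / (ENNReal.ofReal p₀ * p₁) + 1 / p₂ = 1)
    (hlt : 0 < s → 1 < ENNReal.ofReal (s / d) + (1 / (ENNReal.ofReal p₀ * p₁) + 1 / p₂)) :
    ∃ C' : ℝ, 0 < C' ∧
      ∀ A B C : (Fin d → ℤ) → ℝ≥0∞, A 0 = 0 → B 0 = 0 → C 0 = 0 →
        lpNorm p₁ (fun k => ENNReal.ofReal (znorm k ^ (p₀ * s)) * A k) ≠ ∞ →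
        lpNorm p₂ (fun k => ENNReal.ofReal (znorm k ^ s) * B k) ≠ ∞ →
        lpNorm (ENNReal.ofReal p₀) (fun k => ENNReal.ofReal (znorm k ^ (-s)) * C k) ≠ ∞ →
        ∑' k, A k * (∑' j, B j * C (k - j)) ^ p₀ ≤
          ENNReal.ofReal C' *
            lpNorm p₁ (fun k => ENNReal.ofReal (znorm k ^ (p₀ * s)) * A k) *
            lpNorm p₂ (fun k => ENNReal.ofReal (znorm k ^ s) * B k) ^ p₀ *
            lpNorm (ENNReal.ofReal p₀)
              (fun k => ENNReal.ofReal (znorm k ^ (-s)) * C k) ^ p₀ := by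
  have hp : 0 < p₀ := by linarith
  have hd0 : (0 : ℝ) < d := by exact_mod_cast hd
  set u : ℝ := p₁⁻¹.toReal with hu
  set v : ℝ := p₂⁻¹.toReal with hv
  have hu_eq : ENNReal.ofReal u = p₁⁻¹ :=
    ENNReal.ofReal_toReal (ENNReal.inv_ne_top.2 (by positivity))
  have hv_eq : ENNReal.ofReal v = p₂⁻¹ :=
    ENNReal.ofReal_toReal (ENNReal.inv_ne_top.2 (by positivity))
  have hu0 : 0 ≤ u := ENNReal.toReal_nonneg
  have hv0 : 0 ≤ v := ENNReal.toReal_nonneg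
  have hsum : 1 / (ENNReal.ofReal p₀ * p₁) + 1 / p₂ = ENNReal.ofReal (u / p₀ + v) := by
    rw [ENNReal.ofReal_add (by positivity) hv0, ENNReal.ofReal_div_of_pos hp, hu_eq, hv_eq,
      one_div, one_div, ENNReal.mul_inv (Or.inl (by simpa using hp)) (Or.inl ENNReal.ofReal_ne_top),
      mul_comm, ENNReal.div_eq_inv_mul, mul_comm]
  rw [hsum] at hle heq hlt
  have hvp : 1 - 1 / p₀ ≤ v := by
    rw [← ENNReal.ofReal_le_ofReal_iff hv0, hv_eq]
    have h := ENNReal.inv_le_inv.2 hp₂'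
    rw [ENNReal.inv_div (Or.inl (by finiteness)) (Or.inr (by simpa using hp)),
      ← ENNReal.ofReal_one, ← ENNReal.ofReal_sub _ zero_le_one,
      ← ENNReal.ofReal_div_of_pos hp, sub_div, div_self hp.ne'] at h
    exact h
  obtain ⟨δ, hδ⟩ : ∃ δ : ℝ, δ = 1 - (u / p₀ + v) := ⟨_, rfl⟩
  have hδ0 : 0 ≤ δ := by
    rw [hδ, sub_nonneg, ← ENNReal.ofReal_le_one]
    exact hle
  have hδs : 0 < δ → δ * d < s := by
    intro h
    rcases hs.eq_or_lt with hs0 | hs0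
    · have := heq hs0.symm
      rw [ENNReal.ofReal_eq_one] at this
      linarith
    · have := hlt hs0
      rw [← ENNReal.ofReal_add (by positivity) (by positivity), ENNReal.one_lt_ofReal] at this
      rw [← lt_div_iff₀ hd0]
      linarith
  have hM := recipNorm_znorm_lt_top (d := d) hs hδ0 hδs
  set K : ℝ≥0∞ := ENNReal.ofReal (2 ^ s) ^ p₀ * 2 ^ (p₀ - 1) *
    (2 * recipNorm δ (fun k : Fin d → ℤ => ENNReal.ofReal (znorm k ^ (-s))) ^ p₀) with hK
  have hK_top : K ≠ ∞ := by
    have h1 := ENNReal.rpow_ne_top_of_nonneg hp.le hM.ne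
    have h2 := ENNReal.rpow_ne_top_of_nonneg hp.le (ENNReal.ofReal_ne_top (r := 2 ^ s))
    have h3 : (2 : ℝ≥0∞) ^ (p₀ - 1) ≠ ∞ :=
      ENNReal.rpow_ne_top_of_nonneg (by linarith) (by norm_num)
    exact ENNReal.mul_ne_top (ENNReal.mul_ne_top h2 h3) (ENNReal.mul_ne_top (by norm_num) h1)
  refine ⟨K.toReal + 1, by positivity, fun A B C hA hB hC _ _ _ => ?_⟩
  have hKle : K ≤ ENNReal.ofReal (K.toReal + 1) := by
    rw [← ENNReal.ofReal_toReal hK_top]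
    exact ENNReal.ofReal_le_ofReal (by simp)
  have hC_eq : lpNorm (ENNReal.ofReal p₀) (fun k => ENNReal.ofReal (znorm k ^ (-s)) * C k) ^ p₀ =
      ∑' k, (ENNReal.ofReal (znorm k ^ (-s)) * C k) ^ p₀ := by
    rw [lpNorm, if_neg ENNReal.ofReal_ne_top, ENNReal.toReal_ofReal hp.le, ← ENNReal.rpow_mul,
      one_div_mul_cancel hp.ne', ENNReal.rpow_one]
  rw [hC_eq, lpNorm_eq_recipNorm hp₁, lpNorm_eq_recipNorm hp₂, ← hu, ← hv]
  refine (tsum_mul_convolution_rpow_le_of_weight hs hp₀ hu0 hvp hδ0 (by linarith)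
    hA hB hC).trans ?_
  rw [← hK]
  gcongr
end

section
/- Let d ≥ 2 and γ ∈ (0, d/2), and set ε_N := (∑_{k ∈ ℤ^d₀, |k| ≤ N} |k|^{−2γ})^{−1} and D_N := ε_N ∑_{k ∈ ℤ^d₀, |k| ≤ N} |k|^{−2γ−1}. Then there exists a constant c > 0 (depending on d and γ) such that, as N → ∞: (a) if γ ∈ ((d−1)/2, d/2), then N^{d−2γ} D_N → c; (b) if γ = (d−1)/2, then (N/log N) D_N → c; (c) if γ ∈ (0, (d−1)/2), then N D_N → c. -/
/-- `ε_N = (∑_{k ∈ ℤ^d₀, |k| ≤ N} |k|^{-2γ})⁻¹`. -/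
noncomputable def epsN (d : ℕ) (γ : ℝ) (N : ℕ) : ℝ :=
  (∑' k : Fin d → ℤ, if k ≠ 0 ∧ znorm k ≤ N then znorm k ^ (-(2 : ℝ) * γ) else 0)⁻¹

/-- `D_N = ε_N ∑_{k ∈ ℤ^d₀, |k| ≤ N} |k|^{-2γ-1}`. -/
noncomputable def DN (d : ℕ) (γ : ℝ) (N : ℕ) : ℝ :=
  epsN d γ N *
    ∑' k : Fin d → ℤ, if k ≠ 0 ∧ znorm k ≤ N then znorm k ^ (-(2 : ℝ) * γ - 1) else 0

open Filter Topology Finset Asymptotics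

/-- A Stolz–Cesàro theorem: if `a n / g n → L` and the partial sums of `g ≥ 0` are asymptotic to
`G → ∞`, then the partial sums of `a` are asymptotic to `L * G`. -/
theorem tendsto_sum_range_div {a g : ℕ → ℝ} {G : ℕ → ℝ} {L : ℝ} (hg : ∀ n, 0 ≤ g n)
    (hag : Tendsto (fun n => a n / g n) atTop (𝓝 L)) (hg0 : ∀ᶠ n in atTop, g n ≠ 0)
    (hG : ∀ᶠ n in atTop, G n ≠ 0)
    (hsum : Tendsto G atTop atTop)
    (hGg : Tendsto (fun n => (∑ i ∈ range n, g i) / G n) atTop (𝓝 1)) :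
    Tendsto (fun n => (∑ i ∈ range n, a i) / G n) atTop (𝓝 L) := by
  have hGtop : Tendsto (fun n => ∑ i ∈ range n, g i) atTop atTop := by
    refine (hsum.atTop_mul_pos one_pos hGg).congr' ?_
    filter_upwards [hG] with n hn
    field_simp
  have h1 : (fun n => a n - L * g n) =o[atTop] g := by
    rw [isLittleO_iff_tendsto' (hg0.mono fun n h h' => absurd h' h)]
    have := hag.sub_const L
    rw [sub_self] at this
    refine this.congr' ?_
    filter_upwards [hg0] with n hn
    field_simp
  have h2 := (h1.sum_range hg hGtop).tendsto_div_nhds_zero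
  have h3 := (h2.add_const L).mul hGg
  rw [zero_add, mul_one] at h3
  refine h3.congr' ?_
  filter_upwards [hG, hGtop.eventually_ne_atTop 0] with n hn hn'
  rw [sum_sub_distrib, ← mul_sum]
  field_simp
  ring

theorem tendsto_rpow_succ_sub (p : ℝ) :
    Tendsto (fun m : ℕ => (((m : ℝ) + 1) ^ p - (m : ℝ) ^ p) / (m : ℝ) ^ (p - 1)) atTop (𝓝 p) := by
  have h : HasDerivAt (fun x : ℝ => x ^ p) p 1 := by
    simpa using Real.hasDerivAt_rpow_const (x := 1) (p := p) (Or.inl one_ne_zero)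
  have h0 : Tendsto (fun m : ℕ => ((m : ℝ))⁻¹) atTop (𝓝[≠] 0) := by
    refine tendsto_nhdsWithin_iff.2 ⟨tendsto_inv_atTop_nhds_zero_nat, ?_⟩
    filter_upwards [eventually_gt_atTop 0] with m hm
    simp; omega
  have := (hasDerivAt_iff_tendsto_slope_zero.1 h).comp h0
  refine this.congr' ?_
  filter_upwards [eventually_gt_atTop 0] with m hm
  have hm' : (0:ℝ) < m := by exact_mod_cast hm
  simp only [Function.comp, smul_eq_mul, inv_inv, Real.one_rpow]
  have e : (1 + (m:ℝ)⁻¹) = (m + 1) / m := by field_simp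
  rw [e, Real.div_rpow (by positivity) hm'.le, Real.rpow_sub_one hm'.ne']
  have : (m:ℝ)^p ≠ 0 := (Real.rpow_pos_of_pos hm' p).ne'
  field_simp

theorem tendsto_log_succ_sub :
    Tendsto (fun m : ℕ => (Real.log ((m : ℝ) + 1) - Real.log m) * m) atTop (𝓝 1) := by
  have h : HasDerivAt Real.log 1 1 := by
    simpa using Real.hasDerivAt_log (x := 1) one_ne_zero
  have h0 : Tendsto (fun m : ℕ => ((m : ℝ))⁻¹) atTop (𝓝[≠] 0) := by
    refine tendsto_nhdsWithin_iff.2 ⟨tendsto_inv_atTop_nhds_zero_nat, ?_⟩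
    filter_upwards [eventually_gt_atTop 0] with m hm
    simp; omega
  have := (hasDerivAt_iff_tendsto_slope_zero.1 h).comp h0
  refine this.congr' ?_
  filter_upwards [eventually_gt_atTop 0] with m hm
  have hm' : (0:ℝ) < m := by exact_mod_cast hm
  simp only [Function.comp, smul_eq_mul, inv_inv, Real.log_one, sub_zero]
  have e : (1 + (m:ℝ)⁻¹) = (m + 1) / m := by field_simp
  rw [e, Real.log_div (by positivity) hm'.ne']
  ring

section Abel
variable {R T : ℕ → ℝ} {p δ v : ℝ}

theorem abel_identity (hR0 : R 0 = 0) (hT0 : T 0 = 0)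
    (hT : ∀ m : ℕ, T (m + 1) = T m + ((m : ℝ) + 1) ^ (-p) * (R (m + 1) - R m)) (M : ℕ) :
    T M = (M : ℝ) ^ (-p) * R M
      + ∑ m ∈ range M, ((m : ℝ) ^ (-p) - ((m : ℝ) + 1) ^ (-p)) * R m := by
  induction M with
  | zero => simp [hR0, hT0]
  | succ M ih => rw [hT, ih, sum_range_succ]; push_cast; ring

theorem tendsto_abel_term (hR : Tendsto (fun m : ℕ => R m / (m : ℝ) ^ δ) atTop (𝓝 v)) :
    Tendsto (fun m : ℕ => ((m : ℝ) ^ (-p) - ((m : ℝ) + 1) ^ (-p)) * R m / (m : ℝ) ^ (δ - p - 1))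
      atTop (𝓝 (p * v)) := by
  have := (tendsto_rpow_succ_sub (-p)).neg.mul hR
  rw [neg_neg] at this
  refine this.congr' ?_
  filter_upwards [eventually_gt_atTop 0] with m hm
  have hm' : (0:ℝ) < m := by exact_mod_cast hm
  rw [show δ - p - 1 = (-p - 1) + δ by ring, Real.rpow_add hm' (-p-1)]
  have : (m:ℝ)^(-p-1) ≠ 0 := (Real.rpow_pos_of_pos hm' _).ne'
  have : (m:ℝ)^δ ≠ 0 := (Real.rpow_pos_of_pos hm' _).ne'
  field_simp
  ring

theorem tendsto_boundary (hR : Tendsto (fun m : ℕ => R m / (m : ℝ) ^ δ) atTop (𝓝 v)) :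
    Tendsto (fun m : ℕ => (m : ℝ) ^ (-p) * R m / (m : ℝ) ^ (δ - p)) atTop (𝓝 v) := by
  refine hR.congr' ?_
  filter_upwards [eventually_gt_atTop 0] with m hm
  have hm' : (0:ℝ) < m := by exact_mod_cast hm
  rw [show δ - p = (-p) + δ by ring, Real.rpow_add hm' (-p)]
  have : (m:ℝ)^(-p) ≠ 0 := (Real.rpow_pos_of_pos hm' _).ne'
  field_simp

theorem tendsto_div_rpow_of_lt (hR0 : R 0 = 0) (hT0 : T 0 = 0)
    (hT : ∀ m : ℕ, T (m + 1) = T m + ((m : ℝ) + 1) ^ (-p) * (R (m + 1) - R m))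
    (hR : Tendsto (fun m : ℕ => R m / (m : ℝ) ^ δ) atTop (𝓝 v)) (hpδ : p < δ) :
    Tendsto (fun m : ℕ => T m / (m : ℝ) ^ (δ - p)) atTop (𝓝 (v + p * v / (δ - p))) := by
  have hs : 0 < δ - p := sub_pos.2 hpδ
  have hpow : Tendsto (fun m : ℕ => (m : ℝ) ^ (δ - p)) atTop atTop :=
    (tendsto_rpow_atTop hs).comp tendsto_natCast_atTop_atTop
  have hlt : ∀ m : ℕ, (m : ℝ) ^ (δ - p) < ((m : ℝ) + 1) ^ (δ - p) := fun m =>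
    Real.rpow_lt_rpow (by positivity) (by linarith) hs
  have key : Tendsto (fun M : ℕ => (∑ m ∈ range M,
      ((m : ℝ) ^ (-p) - ((m : ℝ) + 1) ^ (-p)) * R m) / (M : ℝ) ^ (δ - p)) atTop
      (𝓝 (p * v / (δ - p))) := by
    refine tendsto_sum_range_div (g := fun m => ((m : ℝ) + 1) ^ (δ - p) - (m : ℝ) ^ (δ - p))
      (fun n => (sub_pos.2 (hlt n)).le) ?_ (Eventually.of_forall fun n => (sub_pos.2 (hlt n)).ne')
      (hpow.eventually_ne_atTop 0) hpow ?_
    · refine ((tendsto_abel_term hR).div (tendsto_rpow_succ_sub (δ - p)) hs.ne').congr' ?_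
      filter_upwards [eventually_gt_atTop 0] with m hm
      have hm' : (0:ℝ) < m := by exact_mod_cast hm
      simp only [Pi.div_apply]
      exact div_div_div_cancel_right₀ (Real.rpow_pos_of_pos hm' _).ne' _ _
    · refine tendsto_const_nhds.congr' ?_
      filter_upwards [hpow.eventually_ne_atTop 0] with n hn
      have := sum_range_sub (fun m : ℕ => (m : ℝ) ^ (δ - p)) n
      push_cast at this
      rw [this, Real.zero_rpow hs.ne', sub_zero, div_self hn]
  refine ((tendsto_boundary (p := p) hR).add key).congr fun M => ?_
  rw [abel_identity hR0 hT0 hT M, add_div]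

theorem tendsto_div_log_of_eq (hR0 : R 0 = 0) (hT0 : T 0 = 0)
    (hT : ∀ m : ℕ, T (m + 1) = T m + ((m : ℝ) + 1) ^ (-p) * (R (m + 1) - R m))
    (hR : Tendsto (fun m : ℕ => R m / (m : ℝ) ^ p) atTop (𝓝 v)) :
    Tendsto (fun m : ℕ => T m / Real.log m) atTop (𝓝 (p * v)) := by
  have hlog : Tendsto (fun m : ℕ => Real.log m) atTop atTop :=
    Real.tendsto_log_atTop.comp tendsto_natCast_atTop_atTop
  have hle : ∀ m : ℕ, Real.log m ≤ Real.log ((m : ℝ) + 1) := fun m => by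
    rcases Nat.eq_zero_or_pos m with rfl | hm
    · simp
    · exact Real.log_le_log (by exact_mod_cast hm) (by linarith)
  have hlim := (tendsto_abel_term (p := p) hR).div tendsto_log_succ_sub one_ne_zero
  rw [div_one] at hlim
  have key : Tendsto (fun M : ℕ => (∑ m ∈ range M,
      ((m : ℝ) ^ (-p) - ((m : ℝ) + 1) ^ (-p)) * R m) / Real.log M) atTop
      (𝓝 (p * v)) := by
    refine tendsto_sum_range_div (g := fun m => Real.log ((m : ℝ) + 1) - Real.log m)
      (fun n => sub_nonneg.2 (hle n)) ?_ ?_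
      (hlog.eventually_ne_atTop 0) hlog ?_
    · refine hlim.congr' ?_
      filter_upwards [eventually_gt_atTop 0] with m hm
      have hm' : (0:ℝ) < m := by exact_mod_cast hm
      simp only [Pi.div_apply]
      rw [sub_self, zero_sub, Real.rpow_neg_one, div_inv_eq_mul,
        mul_div_mul_right _ _ hm'.ne']
    · filter_upwards [eventually_gt_atTop 0] with m hm
      have hm' : (0:ℝ) < m := by exact_mod_cast hm
      exact (sub_pos.2 (Real.log_lt_log hm' (by linarith))).ne'
    · refine tendsto_const_nhds.congr' ?_
      filter_upwards [hlog.eventually_ne_atTop 0] with n hn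
      have := sum_range_sub (fun m : ℕ => Real.log m) n
      push_cast at this
      rw [this, Real.log_zero, sub_zero, div_self hn]
  have hb : Tendsto (fun m : ℕ => (m : ℝ) ^ (-p) * R m / Real.log m) atTop (𝓝 0) := by
    refine ((tendsto_boundary (p := p) hR).div_atTop hlog).congr fun m => ?_
    rw [sub_self, Real.rpow_zero, div_one]
  have := hb.add key
  rw [zero_add] at this
  refine this.congr fun M => ?_
  rw [abel_identity hR0 hT0 hT M, add_div]

theorem tendsto_of_gt (hp : 0 < p) (hv : 0 < v) (hRnn : ∀ m, 0 ≤ R m)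
    (hR0 : R 0 = 0) (hT0 : T 0 = 0)
    (hT : ∀ m : ℕ, T (m + 1) = T m + ((m : ℝ) + 1) ^ (-p) * (R (m + 1) - R m))
    (hR : Tendsto (fun m : ℕ => R m / (m : ℝ) ^ δ) atTop (𝓝 v)) (hpδ : δ < p) :
    ∃ c, 0 < c ∧ Tendsto T atTop (𝓝 c) := by
  set a : ℕ → ℝ := fun m => ((m : ℝ) ^ (-p) - ((m : ℝ) + 1) ^ (-p)) * R m with ha
  have hdec : ∀ m : ℕ, 0 < m → 0 < (m : ℝ) ^ (-p) - ((m : ℝ) + 1) ^ (-p) := fun m hm =>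
    sub_pos.2 (Real.rpow_lt_rpow_of_neg (by exact_mod_cast hm) (by linarith) (neg_lt_zero.2 hp))
  have hann : ∀ m, 0 ≤ a m := fun m => by
    rcases Nat.eq_zero_or_pos m with rfl | hm
    · simp [ha, hR0]
    · exact mul_nonneg (hdec m hm).le (hRnn m)
  have hsum : Summable a := by
    have hb : a =O[atTop] fun m : ℕ => (m : ℝ) ^ (δ - p - 1) := by
      refine isBigO_of_div_tendsto_nhds ?_ _ (tendsto_abel_term hR)
      filter_upwards [eventually_gt_atTop 0] with m hm h
      have hm' : (0:ℝ) < m := by exact_mod_cast hm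
      exact absurd h (Real.rpow_pos_of_pos hm' _).ne'
    exact summable_of_isBigO_nat (Real.summable_nat_rpow.2 (by linarith)) hb
  obtain ⟨m, hm, hRm⟩ : ∃ m : ℕ, 0 < m ∧ 0 < R m := by
    obtain ⟨m, h1, h2⟩ := ((hR.eventually (lt_mem_nhds hv)).and (eventually_gt_atTop 0)).exists
    have hm' : (0:ℝ) < m := by exact_mod_cast h2
    exact ⟨m, h2, (div_pos_iff_of_pos_right (Real.rpow_pos_of_pos hm' _)).1 h1⟩
  refine ⟨∑' m, a m, hsum.tsum_pos hann m (mul_pos (hdec m hm) hRm), ?_⟩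
  have hpow : Tendsto (fun m : ℕ => (m : ℝ) ^ (δ - p)) atTop (𝓝 0) := by
    have := (tendsto_rpow_neg_atTop (sub_pos.2 hpδ)).comp (tendsto_natCast_atTop_atTop (R := ℝ))
    simpa [Function.comp_def] using this
  have hb := (tendsto_boundary (p := p) hR).mul hpow
  have := hb.add hsum.hasSum.tendsto_sum_nat
  rw [mul_zero, zero_add] at this
  refine this.congr' ?_
  filter_upwards [eventually_gt_atTop 0] with m hm
  have hm' : (0:ℝ) < m := by exact_mod_cast hm
  rw [abel_identity hR0 hT0 hT m, div_mul_cancel₀ _ (Real.rpow_pos_of_pos hm' _).ne']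

end Abel

/-- Squared Euclidean norm of a lattice point, as a natural number. -/
def sqNorm {d : ℕ} (k : Fin d → ℤ) : ℕ := ∑ i, (k i).natAbs ^ 2

theorem znorm_eq_sqrt_sqNorm {d : ℕ} (k : Fin d → ℤ) : znorm k = Real.sqrt (sqNorm k) := by
  simp [znorm, sqNorm, Nat.cast_natAbs]

theorem sqNorm_pos_iff {d : ℕ} {k : Fin d → ℤ} : 0 < sqNorm k ↔ k ≠ 0 := by
  simp [sqNorm, Nat.pos_iff_ne_zero, sum_eq_zero_iff, funext_iff]

theorem znorm_le_natCast_iff {d : ℕ} (k : Fin d → ℤ) (N : ℕ) :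
    znorm k ≤ N ↔ sqNorm k ≤ N ^ 2 := by
  rw [znorm_eq_sqrt_sqNorm, Real.sqrt_le_left (Nat.cast_nonneg N)]
  exact_mod_cast Iff.rfl

theorem znorm_rpow {d : ℕ} (k : Fin d → ℤ) (p : ℝ) :
    znorm k ^ (2 * p) = (sqNorm k : ℝ) ^ p := by
  rw [znorm_eq_sqrt_sqNorm, Real.sqrt_eq_rpow, ← Real.rpow_mul (Nat.cast_nonneg _)]
  congr 1; ring

/-- The lattice points `k` with `|k|² ≤ M`. -/
noncomputable def sqBall (d M : ℕ) : Finset (Fin d → ℤ) :=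
  {k ∈ Icc (fun _ => -(M : ℤ)) (fun _ => (M : ℤ)) | sqNorm k ≤ M}

theorem mem_sqBall {d M : ℕ} {k : Fin d → ℤ} : k ∈ sqBall d M ↔ sqNorm k ≤ M := by
  refine ⟨fun h => (mem_filter.1 h).2, fun h => mem_filter.2 ⟨?_, h⟩⟩
  have hi : ∀ i, |k i| ≤ M := fun i => by
    have h1 : (k i).natAbs ^ 2 ≤ sqNorm k :=
      single_le_sum (f := fun i => (k i).natAbs ^ 2) (fun _ _ => Nat.zero_le _) (mem_univ i)
    have h2 : (k i).natAbs ≤ (k i).natAbs ^ 2 := Nat.le_self_pow two_ne_zero _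
    have h3 := h1.trans h
    rw [Int.abs_eq_natAbs]
    exact_mod_cast h2.trans h3
  exact mem_Icc.2 ⟨fun i => (abs_le.1 (hi i)).1, fun i => (abs_le.1 (hi i)).2⟩

theorem sqBall_zero (d : ℕ) : sqBall d 0 = {0} := by
  ext k
  rw [mem_sqBall, mem_singleton, ← not_iff_not, not_le, sqNorm_pos_iff]

/-- `∑_{0 < |k|² ≤ M} |k|^{-2p}`. -/
noncomputable def powerSum (d : ℕ) (p : ℝ) (M : ℕ) : ℝ :=
  ∑ k ∈ (sqBall d M).erase 0, (sqNorm k : ℝ) ^ (-p)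

theorem powerSum_zero (d : ℕ) (p : ℝ) : powerSum d p 0 = 0 := by
  simp [powerSum, sqBall_zero]

theorem powerSum_succ (d : ℕ) (p : ℝ) (M : ℕ) :
    powerSum d p (M + 1) = powerSum d p M
      + ((M : ℝ) + 1) ^ (-p) * (#((sqBall d (M + 1)).erase 0) - #((sqBall d M).erase 0)) := by
  have hsub : (sqBall d M).erase 0 ⊆ (sqBall d (M + 1)).erase 0 :=
    erase_subset_erase _ fun k hk => mem_sqBall.2 ((mem_sqBall.1 hk).trans M.le_succ)
  have hconst : ∀ k ∈ (sqBall d (M + 1)).erase 0 \ (sqBall d M).erase 0,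
      (sqNorm k : ℝ) ^ (-p) = ((M : ℝ) + 1) ^ (-p) := fun k hk => by
    rw [Finset.mem_sdiff, mem_erase, mem_erase, mem_sqBall, mem_sqBall] at hk
    have : sqNorm k = M + 1 := by
      have h : ¬ sqNorm k ≤ M := fun h => hk.2 ⟨hk.1.1, h⟩
      exact le_antisymm hk.1.2 (not_le.1 h)
    rw [this]; push_cast; rfl
  rw [powerSum, powerSum, ← sum_sdiff hsub, sum_congr rfl hconst, sum_const, nsmul_eq_mul,
    card_sdiff_of_subset hsub, Nat.cast_sub (card_le_card hsub)]
  ring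

theorem tsum_znorm_rpow (d : ℕ) (p : ℝ) (N : ℕ) :
    (∑' k : Fin d → ℤ, if k ≠ 0 ∧ znorm k ≤ N then znorm k ^ (2 * -p) else 0)
      = powerSum d p (N ^ 2) := by
  rw [tsum_eq_sum (s := (sqBall d (N ^ 2)).erase 0), powerSum]
  · refine sum_congr rfl fun k hk => ?_
    rw [mem_erase, mem_sqBall, ← znorm_le_natCast_iff] at hk
    rw [if_pos hk, znorm_rpow]
  · intro k hk
    rw [mem_erase, mem_sqBall, ← znorm_le_natCast_iff] at hk
    rw [if_neg hk]

theorem DN_eq (d : ℕ) (γ : ℝ) (N : ℕ) :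
    DN d γ N = powerSum d (γ + 1 / 2) (N ^ 2) / powerSum d γ (N ^ 2) := by
  rw [DN, epsN, show -(2 : ℝ) * γ - 1 = 2 * -(γ + 1 / 2) by ring,
    show -(2 : ℝ) * γ = 2 * -γ by ring, tsum_znorm_rpow, tsum_znorm_rpow, ← div_eq_inv_mul]

/-- The closed Euclidean unit ball, as a subset of `Fin d → ℝ`. -/
def euclideanUnitBall (d : ℕ) : Set (Fin d → ℝ) := {x | ∑ i, x i ^ 2 ≤ 1}

theorem isBounded_euclideanUnitBall (d : ℕ) : Bornology.IsBounded (euclideanUnitBall d) := by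
  refine (Metric.isBounded_closedBall (x := (0 : Fin d → ℝ)) (r := 1)).subset fun x hx => ?_
  rw [mem_closedBall_zero_iff, pi_norm_le_iff_of_nonneg zero_le_one]
  intro i
  have h1 : x i ^ 2 ≤ ∑ i, x i ^ 2 :=
    single_le_sum (f := fun i => x i ^ 2) (fun _ _ => sq_nonneg _) (mem_univ i)
  rw [Real.norm_eq_abs, ← sq_le_one_iff_abs_le_one]
  exact h1.trans hx

theorem isClosed_euclideanUnitBall (d : ℕ) : IsClosed (euclideanUnitBall d) :=
  isClosed_le (by fun_prop) continuous_const

theorem convex_euclideanUnitBall (d : ℕ) : Convex ℝ (euclideanUnitBall d) := by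
  have h : ConvexOn ℝ Set.univ fun x : Fin d → ℝ => ∑ i, x i ^ 2 := by
    have hi (i : Fin d) : ConvexOn ℝ Set.univ fun x : Fin d → ℝ => x i ^ 2 :=
      (even_two.convexOn_pow (𝕜 := ℝ)).comp_linearMap
        (LinearMap.proj (R := ℝ) (φ := fun _ : Fin d => ℝ) i)
    refine ⟨convex_univ, fun x _ y _ a b ha hb hab => ?_⟩
    rw [smul_sum, smul_sum, ← sum_add_distrib]
    exact sum_le_sum fun i _ => (hi i).2 trivial trivial ha hb hab
  simpa [euclideanUnitBall] using h.convex_le 1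

theorem volume_euclideanUnitBall_pos (d : ℕ) :
    0 < MeasureTheory.volume.real (euclideanUnitBall d) := by
  have hopen : IsOpen {x : Fin d → ℝ | ∑ i, x i ^ 2 < 1} :=
    isOpen_lt (by fun_prop) continuous_const
  refine ENNReal.toReal_pos ?_ (isBounded_euclideanUnitBall d).measure_lt_top.ne
  exact ((hopen.measure_pos _ ⟨0, by simp⟩).trans_le
    (MeasureTheory.measure_mono fun x (hx : ∑ i, x i ^ 2 < 1) => le_of_lt hx)).ne'

open Pointwise in
theorem natCard_euclideanUnitBall_inter {d M : ℕ} (hM : 0 < M) :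
    Nat.card ↑(euclideanUnitBall d ∩
      (√(M : ℝ))⁻¹ • (Submodule.span ℤ (Set.range (Pi.basisFun ℝ (Fin d))) : Set (Fin d → ℝ)))
      = #(sqBall d M) := by
  have hM' : (0 : ℝ) < M := by exact_mod_cast hM
  have hs : 0 < √(M : ℝ) := Real.sqrt_pos.2 hM'
  let e : (Fin d → ℤ) → Fin d → ℝ := fun k => (√(M : ℝ))⁻¹ • fun i => (k i : ℝ)
  have he : Function.Injective e := fun k l h => by
    have := smul_right_injective (Fin d → ℝ) (inv_ne_zero hs.ne') h
    exact funext fun i => by exact_mod_cast congrFun this i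
  have hmem (k : Fin d → ℤ) : e k ∈ euclideanUnitBall d ↔ k ∈ sqBall d M := by
    have : ∑ i, e k i ^ 2 = sqNorm k / M := by
      simp [e, sqNorm, mul_pow, Nat.cast_natAbs, ← mul_sum, div_eq_inv_mul]
    rw [mem_sqBall, euclideanUnitBall, Set.mem_ofPred_eq, this, div_le_one hM', Nat.cast_le]
  have hset : euclideanUnitBall d ∩
      (√(M : ℝ))⁻¹ • (Submodule.span ℤ (Set.range (Pi.basisFun ℝ (Fin d))) : Set (Fin d → ℝ))
      = e '' (sqBall d M : Set (Fin d → ℤ)) := by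
    ext x
    constructor
    · rintro ⟨hx, y, hy, rfl⟩
      have hy' := ((Pi.basisFun ℝ (Fin d)).mem_span_iff_repr_mem ℤ y).1 hy
      choose k hk using hy'
      have hek : e k = (√(M : ℝ))⁻¹ • y := by
        refine congrArg (fun z : Fin d → ℝ => (√(M : ℝ))⁻¹ • z) (funext fun i => ?_)
        simpa using hk i
      refine ⟨k, (hmem k).1 ?_, hek⟩
      rw [hek]; exact hx
    · rintro ⟨k, hk, rfl⟩
      refine ⟨(hmem k).2 hk, Set.smul_mem_smul_set ?_⟩
      exact ((Pi.basisFun ℝ (Fin d)).mem_span_iff_repr_mem ℤ _).2 fun i => ⟨k i, by simp⟩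
  rw [hset, Nat.card_coe_set_eq, Set.ncard_image_of_injective _ he, Set.ncard_coe_finset]

open Pointwise in
theorem tendsto_card_sqBall_div (d : ℕ) :
    Tendsto (fun M : ℕ => (#(sqBall d M) : ℝ) / (M : ℝ) ^ ((d : ℝ) / 2)) atTop
      (𝓝 (MeasureTheory.volume.real (euclideanUnitBall d))) := by
  have h := tendsto_card_div_pow_atTop_volume' (euclideanUnitBall d)
    (isBounded_euclideanUnitBall d) (isClosed_euclideanUnitBall d).measurableSet
    ((convex_euclideanUnitBall d).addHaar_frontier _) ?_
  · refine ((h.comp Real.tendsto_sqrt_atTop).comp tendsto_natCast_atTop_atTop).congr' ?_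
    filter_upwards [eventually_gt_atTop 0] with M hM
    simp only [Function.comp, Fintype.card_fin]
    rw [natCard_euclideanUnitBall_inter hM, Real.sqrt_eq_rpow, ← Real.rpow_natCast,
      ← Real.rpow_mul (Nat.cast_nonneg M)]
    congr 2; ring
  · rintro x y hx hxy _ ⟨z, hz, rfl⟩
    have hy := hx.trans_le hxy
    refine (Set.mem_smul_set_iff_inv_smul_mem₀ hy.ne' _ _).2 ?_
    simp only [smul_smul]
    refine (convex_euclideanUnitBall d).smul_mem_of_zero_mem (by simp [euclideanUnitBall]) hz
      ⟨by positivity, ?_⟩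
    rwa [inv_mul_le_one₀ hy]

theorem tendsto_card_sqBall_erase_div {d : ℕ} (hd : 0 < d) :
    Tendsto (fun M : ℕ => (#((sqBall d M).erase 0) : ℝ) / (M : ℝ) ^ ((d : ℝ) / 2)) atTop
      (𝓝 (MeasureTheory.volume.real (euclideanUnitBall d))) := by
  have hpow : Tendsto (fun M : ℕ => (M : ℝ) ^ ((d : ℝ) / 2)) atTop atTop :=
    (tendsto_rpow_atTop (by positivity)).comp tendsto_natCast_atTop_atTop
  have h := (tendsto_card_sqBall_div d).sub (hpow.inv_tendsto_atTop)
  rw [sub_zero] at h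
  refine h.congr fun M => ?_
  have h0 : (0 : Fin d → ℤ) ∈ sqBall d M := mem_sqBall.2 (by simp [sqNorm])
  rw [card_erase_of_mem h0, Nat.cast_sub (card_pos.2 ⟨0, h0⟩), Nat.cast_one, sub_div, one_div]
  rfl

/-- asymptotics of `D_N`: `D_N ∼ N^{2γ-d}` if `γ ∈ ((d-1)/2, d/2)`,
`D_N ∼ (log N)/N` if `γ = (d-1)/2`, `D_N ∼ N^{-1}` if `γ ∈ (0, (d-1)/2)`. -/
theorem stmt8 {d : ℕ} (hd : 2 ≤ d) (γ : ℝ) (hγ : 0 < γ ∧ γ < d / 2) :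
    ∃ c : ℝ, 0 < c ∧
      (((d : ℝ) - 1) / 2 < γ →
        Filter.Tendsto (fun N : ℕ => (N : ℝ) ^ ((d : ℝ) - 2 * γ) * DN d γ N)
          Filter.atTop (nhds c)) ∧
      (γ = ((d : ℝ) - 1) / 2 →
        Filter.Tendsto (fun N : ℕ => ((N : ℝ) / Real.log N) * DN d γ N)
          Filter.atTop (nhds c)) ∧
      (γ < ((d : ℝ) - 1) / 2 →
        Filter.Tendsto (fun N : ℕ => (N : ℝ) * DN d γ N) Filter.atTop (nhds c)) := by
  obtain ⟨hγ0, hγd⟩ := hγ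
  have hv := volume_euclideanUnitBall_pos d
  set v := MeasureTheory.volume.real (euclideanUnitBall d)
  have hR := tendsto_card_sqBall_erase_div (d := d) (by omega)
  have hR0 : (#((sqBall d 0).erase 0) : ℝ) = 0 := by simp [sqBall_zero]
  have hsq : Tendsto (fun N : ℕ => N ^ 2) atTop atTop := tendsto_pow_atTop two_ne_zero
  have hcast (N : ℕ) (s : ℝ) : ((N ^ 2 : ℕ) : ℝ) ^ s = (N : ℝ) ^ (2 * s) := by
    rw [Nat.cast_pow, ← Real.rpow_natCast, ← Real.rpow_mul (Nat.cast_nonneg N)]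
    rfl
  have hsub {p : ℝ} (hp0 : 0 < p) (hp : p < d / 2) :
      ∃ A, 0 < A ∧ Tendsto (fun N : ℕ => powerSum d p (N ^ 2) / (N : ℝ) ^ ((d : ℝ) - 2 * p))
        atTop (𝓝 A) := by
    have h := (tendsto_div_rpow_of_lt (R := fun M => (#((sqBall d M).erase 0) : ℝ))
      (T := powerSum d p) hR0 (powerSum_zero d p)
      (powerSum_succ d p) hR hp).comp hsq
    have := sub_pos.2 hp
    refine ⟨_, by positivity, h.congr fun N => ?_⟩
    rw [Function.comp, hcast]
    congr 2; ring
  obtain ⟨A, hA, hden⟩ := hsub hγ0 hγd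
  rcases lt_trichotomy (((d : ℝ) - 1) / 2) γ with h | h | h
  · obtain ⟨C, hC, hnum⟩ := tendsto_of_gt (R := fun M => (#((sqBall d M).erase 0) : ℝ))
      (T := powerSum d (γ + 1 / 2)) (p := γ + 1 / 2)
      (by linarith) hv (fun m => Nat.cast_nonneg _) hR0 (powerSum_zero d _)
      (powerSum_succ d _) hR (by linarith)
    refine ⟨C / A, div_pos hC hA, fun _ => ?_, fun h' => absurd h' h.ne',
      fun h' => absurd h' h.not_gt⟩
    refine ((hnum.comp hsq).div hden hA.ne').congr fun N => ?_
    rw [DN_eq]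
    simp only [Pi.div_apply, Function.comp]
    rw [div_div_eq_mul_div]
    ring
  · have hnum := (tendsto_div_log_of_eq (R := fun M => (#((sqBall d M).erase 0) : ℝ))
      (T := powerSum d (γ + 1 / 2)) (p := γ + 1 / 2) (v := v)
      hR0 (powerSum_zero d _) (powerSum_succ d _)
      (by rwa [show γ + 1 / 2 = (d : ℝ) / 2 by linarith])).comp hsq
    refine ⟨2 * ((γ + 1 / 2) * v) / A, by positivity, fun h' => absurd h h'.ne, fun _ => ?_,
      fun h' => absurd h h'.ne'⟩
    refine ((hnum.const_mul 2).div hden hA.ne').congr fun N => ?_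
    rw [DN_eq]
    simp only [Pi.div_apply, Function.comp]
    rw [show (d : ℝ) - 2 * γ = 1 by rw [← h]; ring, Real.rpow_one, Nat.cast_pow, Real.log_pow,
      div_div_eq_mul_div, Nat.cast_ofNat]
    field_simp
  · obtain ⟨B, hB, hnum⟩ := hsub (p := γ + 1 / 2) (by linarith) (by linarith)
    refine ⟨B / A, div_pos hB hA, fun h' => absurd h' h.not_gt, fun h' => absurd h' h.ne,
      fun _ => ?_⟩
    refine (hnum.div hden hA.ne').congr' ?_
    filter_upwards [eventually_gt_atTop 0] with N hN
    have hN' : (0 : ℝ) < N := by exact_mod_cast hN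
    rw [DN_eq]
    simp only [Pi.div_apply]
    rw [show (d : ℝ) - 2 * γ = (d - 2 * (γ + 1 / 2)) + 1 by ring, Real.rpow_add_one hN'.ne']
    have := (Real.rpow_pos_of_pos hN' (d - 2 * (γ + 1 / 2))).ne'
    field_simp
end

section
/- Let d ≥ 1, let a, b ∈ ℝ^d be unit vectors, and let k, l ∈ ℝ^d with k ≠ 0 and k ≠ l. Then |(a·(k−l))(b·(k−l))/|k−l|² − (a·k)(b·k)/|k|²| ≤ 4|l|/|k|. -/
open scoped RealInnerProductSpace

theorem norm_mul_norm_inv_smul_sub_le {E : Type*} [NormedAddCommGroup E] [NormedSpace ℝ E]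
    {x y : E} (hx : x ≠ 0) (hy : y ≠ 0) :
    ‖y‖ * ‖‖x‖⁻¹ • x - ‖y‖⁻¹ • y‖ ≤ 2 * ‖x - y‖ := by
  have hx' : ‖x‖ ≠ 0 := norm_ne_zero_iff.mpr hx
  have hy' : ‖y‖ ≠ 0 := norm_ne_zero_iff.mpr hy
  have hdecomp : ‖y‖ • (‖x‖⁻¹ • x - ‖y‖⁻¹ • y) = (‖y‖ - ‖x‖) • (‖x‖⁻¹ • x) + (x - y) := by
    rw [smul_sub, sub_smul, smul_inv_smul₀ hx', smul_inv_smul₀ hy']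
    abel
  calc ‖y‖ * ‖‖x‖⁻¹ • x - ‖y‖⁻¹ • y‖
      = ‖(‖y‖ - ‖x‖) • (‖x‖⁻¹ • x) + (x - y)‖ := by rw [← hdecomp, norm_smul, norm_norm]
    _ ≤ ‖(‖y‖ - ‖x‖) • (‖x‖⁻¹ • x)‖ + ‖x - y‖ := norm_add_le _ _
    _ = |‖y‖ - ‖x‖| + ‖x - y‖ := by
      rw [norm_smul, norm_smul, norm_inv, norm_norm, inv_mul_cancel₀ hx', mul_one, Real.norm_eq_abs]
    _ ≤ 2 * ‖x - y‖ := by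
      have h := abs_norm_sub_norm_le y x
      rw [norm_sub_rev y x] at h
      linarith

theorem abs_inner_mul_inner_sub_inner_mul_inner_le {E : Type*} [NormedAddCommGroup E]
    [InnerProductSpace ℝ E] (a b u v : E) :
    |⟪a, u⟫ * ⟪b, u⟫ - ⟪a, v⟫ * ⟪b, v⟫| ≤ ‖a‖ * ‖b‖ * (‖u‖ + ‖v‖) * ‖u - v‖ := by
  have hdecomp : ⟪a, u⟫ * ⟪b, u⟫ - ⟪a, v⟫ * ⟪b, v⟫ =
      ⟪a, u⟫ * ⟪b, u - v⟫ + ⟪a, u - v⟫ * ⟪b, v⟫ := by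
    rw [inner_sub_right, inner_sub_right]
    ring
  calc |⟪a, u⟫ * ⟪b, u⟫ - ⟪a, v⟫ * ⟪b, v⟫|
      ≤ |⟪a, u⟫| * |⟪b, u - v⟫| + |⟪a, u - v⟫| * |⟪b, v⟫| := by
        rw [hdecomp, ← abs_mul, ← abs_mul]
        exact abs_add_le _ _
    _ ≤ (‖a‖ * ‖u‖) * (‖b‖ * ‖u - v‖) + (‖a‖ * ‖u - v‖) * (‖b‖ * ‖v‖) := by
        gcongr <;> exact abs_real_inner_le_norm _ _
    _ = ‖a‖ * ‖b‖ * (‖u‖ + ‖v‖) * ‖u - v‖ := by ring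

theorem inner_mul_inner_div_norm_sq {E : Type*} [NormedAddCommGroup E] [InnerProductSpace ℝ E]
    (a b x : E) :
    ⟪a, x⟫ * ⟪b, x⟫ / ‖x‖ ^ 2 = ⟪a, ‖x‖⁻¹ • x⟫ * ⟪b, ‖x‖⁻¹ • x⟫ := by
  rw [real_inner_smul_right, real_inner_smul_right]
  ring

/-- for unit vectors `a, b` and `k ≠ 0`, `k ≠ l` in `ℝ^d`,
`|(a·(k-l))(b·(k-l))/|k-l|² - (a·k)(b·k)/|k|²| ≤ 4|l|/|k|`. -/
theorem stmt10 {d : ℕ} (hd : 1 ≤ d) (a b k l : EuclideanSpace ℝ (Fin d))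
    (ha : ‖a‖ = 1) (hb : ‖b‖ = 1) (hk : k ≠ 0) (hkl : k ≠ l) :
    |⟪a, k - l⟫ * ⟪b, k - l⟫ / ‖k - l‖ ^ 2 - ⟪a, k⟫ * ⟪b, k⟫ / ‖k‖ ^ 2| ≤
      4 * ‖l‖ / ‖k‖ := by
  have hp : k - l ≠ 0 := sub_ne_zero.mpr hkl
  have hdir := norm_mul_norm_inv_smul_sub_le hp hk
  rw [sub_sub_cancel_left, norm_neg] at hdir
  have hinner := abs_inner_mul_inner_sub_inner_mul_inner_le a b
    (‖k - l‖⁻¹ • (k - l)) (‖k‖⁻¹ • k)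
  have hu : ‖‖k - l‖⁻¹ • (k - l)‖ = 1 := norm_smul_inv_norm (𝕜 := ℝ) hp
  have hv : ‖‖k‖⁻¹ • k‖ = 1 := norm_smul_inv_norm (𝕜 := ℝ) hk
  rw [ha, hb, hu, hv] at hinner
  rw [inner_mul_inner_div_norm_sq, inner_mul_inner_div_norm_sq, le_div_iff₀ (norm_pos_iff.mpr hk)]
  nlinarith [mul_le_mul_of_nonneg_right hinner (norm_nonneg k)]
end

section
/- Let d ≥ 2 and γ ∈ (0, d/2). For any l ∈ ℤ^d₀, any unit vectors a, b ∈ ℝ^d, and all N ≥ 1, one has |∑_{k ∈ ℤ^d₀, k ≠ l} (θ^N_k)² sin²(∠_{k,l}) ( (a·(k−l))(b·(k−l))/|k−l|² − (a·k)(b·k)/|k|² )| ≤ 4 |l| D_N. -/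
/-- Euclidean inner product of two lattice points. -/
noncomputable def zdot {d : ℕ} (k l : Fin d → ℤ) : ℝ :=
  ∑ i, (k i : ℝ) * (l i : ℝ)

/-- Inner product of a real vector with a lattice point. -/
noncomputable def rdot {d : ℕ} (a : Fin d → ℝ) (k : Fin d → ℤ) : ℝ :=
  ∑ i, a i * (k i : ℝ)

/-- `sin²(∠_{k,l}) = 1 - (k·l)²/(|k|²|l|²)`. -/
noncomputable def sin2 {d : ℕ} (k l : Fin d → ℤ) : ℝ :=
  1 - zdot k l ^ 2 / (znorm k ^ 2 * znorm l ^ 2)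

/-- `θ^N_k = √ε_N |k|^{-γ} 1_{1 ≤ |k| ≤ N}`. -/
noncomputable def thetaN (d : ℕ) (γ : ℝ) (N : ℕ) (k : Fin d → ℤ) : ℝ :=
  if 1 ≤ znorm k ∧ znorm k ≤ N then Real.sqrt (epsN d γ N) * znorm k ^ (-γ) else 0

/-- Orthogonal projections onto two lines differ, as bilinear forms, by at most four times the
relative distance of the spanning vectors. -/
theorem abs_inner_mul_inner_div_sub_le {E : Type*} [NormedAddCommGroup E] [InnerProductSpace ℝ E]
    {a b : E} (ha : ‖a‖ = 1) (hb : ‖b‖ = 1) {k m : E} (hk : k ≠ 0) (hm : m ≠ 0) :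
    |inner ℝ a m * inner ℝ b m / ‖m‖ ^ 2 - inner ℝ a k * inner ℝ b k / ‖k‖ ^ 2| ≤
      4 * ‖k - m‖ / ‖k‖ := by
  have hk' : 0 < ‖k‖ := norm_pos_iff.2 hk
  have hm' : 0 < ‖m‖ := norm_pos_iff.2 hm
  set u : E := ‖m‖⁻¹ • m with hu
  set v : E := ‖k‖⁻¹ • k with hv
  have hun : ‖u‖ = 1 := by rw [hu, norm_smul, norm_inv, norm_norm, inv_mul_cancel₀ hm'.ne']
  have hvn : ‖v‖ = 1 := by rw [hv, norm_smul, norm_inv, norm_norm, inv_mul_cancel₀ hk'.ne']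
  have huv : ‖u - v‖ ≤ 2 * ‖k - m‖ / ‖k‖ := by
    have h1 : u - v = (‖k‖⁻¹ * (‖k‖ - ‖m‖)) • u - ‖k‖⁻¹ • (k - m) := by
      have : ‖k‖⁻¹ * (‖k‖ - ‖m‖) = 1 - ‖k‖⁻¹ * ‖m‖ := by field_simp
      rw [this, sub_smul, one_smul, hu, smul_smul (‖k‖⁻¹ * ‖m‖), mul_assoc,
        mul_inv_cancel₀ hm'.ne', mul_one, smul_sub, hv]
      abel
    calc ‖u - v‖ ≤ ‖(‖k‖⁻¹ * (‖k‖ - ‖m‖)) • u‖ + ‖‖k‖⁻¹ • (k - m)‖ := h1 ▸ norm_sub_le _ _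
      _ = ‖k‖⁻¹ * |‖k‖ - ‖m‖| + ‖k‖⁻¹ * ‖k - m‖ := by
        rw [norm_smul _ u, norm_smul _ (k - m), hun, mul_one, norm_mul, norm_inv, norm_norm, Real.norm_eq_abs]
      _ ≤ ‖k‖⁻¹ * ‖k - m‖ + ‖k‖⁻¹ * ‖k - m‖ := by
        gcongr
        exact abs_norm_sub_norm_le k m
      _ = 2 * ‖k - m‖ / ‖k‖ := by ring
  have hsplit : inner ℝ a m * inner ℝ b m / ‖m‖ ^ 2 - inner ℝ a k * inner ℝ b k / ‖k‖ ^ 2 =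
      inner ℝ a (u - v) * inner ℝ b u + inner ℝ a v * inner ℝ b (u - v) := by
    simp only [hu, hv, inner_sub_right, real_inner_smul_right]
    ring
  have h1 := abs_real_inner_le_norm a (u - v)
  have h2 := abs_real_inner_le_norm b u
  have h3 := abs_real_inner_le_norm a v
  have h4 := abs_real_inner_le_norm b (u - v)
  rw [ha, one_mul] at h1 h3
  rw [hb, one_mul] at h2 h4
  rw [hun] at h2
  rw [hvn] at h3
  calc _ ≤ |inner ℝ a (u - v)| * |inner ℝ b u| + |inner ℝ a v| * |inner ℝ b (u - v)| := by
        rw [hsplit, ← abs_mul, ← abs_mul]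
        exact abs_add_le _ _
    _ ≤ ‖u - v‖ * 1 + 1 * ‖u - v‖ := by gcongr
    _ ≤ 4 * ‖k - m‖ / ‖k‖ := by
      have : 4 * ‖k - m‖ / ‖k‖ = 2 * (2 * ‖k - m‖ / ‖k‖) := by ring
      linarith

/-- A lattice point as a vector of Euclidean space. -/
noncomputable def latticeVec {d : ℕ} (k : Fin d → ℤ) : EuclideanSpace ℝ (Fin d) :=
  WithLp.toLp 2 fun i => (k i : ℝ)

theorem latticeVec_sub {d : ℕ} (k l : Fin d → ℤ) :
    latticeVec (k - l) = latticeVec k - latticeVec l := by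
  ext i
  simp [latticeVec]

theorem latticeVec_ne_zero {d : ℕ} {k : Fin d → ℤ} (hk : k ≠ 0) : latticeVec k ≠ 0 := by
  contrapose! hk
  ext i
  have := congrArg (fun x : EuclideanSpace ℝ (Fin d) => x i) hk
  simpa [latticeVec] using this

theorem norm_latticeVec {d : ℕ} (k : Fin d → ℤ) : ‖latticeVec k‖ = znorm k := by
  simp [latticeVec, znorm, EuclideanSpace.norm_eq]

theorem inner_latticeVec {d : ℕ} (k l : Fin d → ℤ) :
    inner ℝ (latticeVec k) (latticeVec l) = zdot k l := by
  simp [latticeVec, zdot, PiLp.inner_apply, mul_comm]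

theorem inner_toLp_latticeVec {d : ℕ} (a : Fin d → ℝ) (k : Fin d → ℤ) :
    inner ℝ (WithLp.toLp 2 a : EuclideanSpace ℝ (Fin d)) (latticeVec k) = rdot a k := by
  simp [latticeVec, rdot, PiLp.inner_apply, mul_comm]

theorem norm_toLp_eq_one {d : ℕ} {a : Fin d → ℝ} (ha : ∑ i, a i ^ 2 = 1) :
    ‖(WithLp.toLp 2 a : EuclideanSpace ℝ (Fin d))‖ = 1 := by
  simp [EuclideanSpace.norm_eq, ha]

theorem znorm_pos {d : ℕ} {k : Fin d → ℤ} (hk : k ≠ 0) : 0 < znorm k := by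
  rw [← norm_latticeVec]
  exact norm_pos_iff.2 (latticeVec_ne_zero hk)

theorem abs_sin2_le_one {d : ℕ} (k l : Fin d → ℤ) : |sin2 k l| ≤ 1 := by
  have h := abs_real_inner_le_norm (latticeVec k) (latticeVec l)
  rw [inner_latticeVec, norm_latticeVec, norm_latticeVec] at h
  have h0 : 0 ≤ zdot k l ^ 2 / (znorm k ^ 2 * znorm l ^ 2) := by positivity
  have h1 : zdot k l ^ 2 / (znorm k ^ 2 * znorm l ^ 2) ≤ 1 := by
    refine div_le_one_of_le₀ ?_ (by positivity)
    rw [← mul_pow, ← sq_abs (zdot k l)]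
    gcongr
  rw [sin2, abs_le]
  constructor <;> linarith

theorem abs_rdot_mul_rdot_div_sub_le {d : ℕ} {a b : Fin d → ℝ} (ha : ∑ i, a i ^ 2 = 1)
    (hb : ∑ i, b i ^ 2 = 1) {k l : Fin d → ℤ} (hk : k ≠ 0) (hkl : k ≠ l) :
    |rdot a (k - l) * rdot b (k - l) / znorm (k - l) ^ 2 - rdot a k * rdot b k / znorm k ^ 2| ≤
      4 * znorm l / znorm k := by
  have h := abs_inner_mul_inner_div_sub_le (norm_toLp_eq_one ha) (norm_toLp_eq_one hb)
    (latticeVec_ne_zero hk) (latticeVec_ne_zero (sub_ne_zero.2 hkl))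
  rwa [← latticeVec_sub, sub_sub_cancel, inner_toLp_latticeVec, inner_toLp_latticeVec,
    inner_toLp_latticeVec, inner_toLp_latticeVec, norm_latticeVec, norm_latticeVec,
    norm_latticeVec] at h

theorem finite_setOf_znorm_le (d : ℕ) (R : ℝ) : {k : Fin d → ℤ | znorm k ≤ R}.Finite := by
  refine (Set.finite_Icc (fun _ => -⌈R⌉ : Fin d → ℤ) fun _ => ⌈R⌉).subset fun k hk => ?_
  have h (i : Fin d) : |k i| ≤ ⌈R⌉ := by
    have h1 := PiLp.norm_apply_le (latticeVec k) i
    rw [norm_latticeVec] at h1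
    have h2 : |(k i : ℝ)| ≤ ⌈R⌉ := (h1.trans hk).trans (Int.le_ceil R)
    exact_mod_cast h2
  exact ⟨fun i => (abs_le.1 (h i)).1, fun i => (abs_le.1 (h i)).2⟩

theorem epsN_nonneg (d : ℕ) (γ : ℝ) (N : ℕ) : 0 ≤ epsN d γ N := by
  refine inv_nonneg.2 (tsum_nonneg fun k => ?_)
  split_ifs
  · exact Real.rpow_nonneg (Real.sqrt_nonneg _) _
  · exact le_rfl

theorem thetaN_sq_le {d : ℕ} (γ : ℝ) (N : ℕ) {k : Fin d → ℤ} (hk : k ≠ 0) :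
    thetaN d γ N k ^ 2 ≤
      epsN d γ N * if k ≠ 0 ∧ znorm k ≤ N then znorm k ^ (-(2 : ℝ) * γ) else 0 := by
  have hpos := znorm_pos hk
  have heps := epsN_nonneg d γ N
  by_cases h : 1 ≤ znorm k ∧ znorm k ≤ N
  · rw [thetaN, if_pos h, if_pos ⟨hk, h.2⟩, mul_pow, Real.sq_sqrt heps, ← Real.rpow_mul_natCast
      hpos.le]
    apply le_of_eq
    congr 2
    push_cast
    ring
  · rw [thetaN, if_neg h, zero_pow two_ne_zero]
    split_ifs <;> positivity

theorem summand_abs_le {d : ℕ} (γ : ℝ) (N : ℕ) {a b : Fin d → ℝ} (ha : ∑ i, a i ^ 2 = 1)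
    (hb : ∑ i, b i ^ 2 = 1) (k l : Fin d → ℤ) :
    |if k ≠ 0 ∧ k ≠ l then
        thetaN d γ N k ^ 2 * sin2 k l *
          (rdot a (k - l) * rdot b (k - l) / znorm (k - l) ^ 2 -
            rdot a k * rdot b k / znorm k ^ 2)
      else 0| ≤
      4 * znorm l * epsN d γ N *
        if k ≠ 0 ∧ znorm k ≤ N then znorm k ^ (-(2 : ℝ) * γ - 1) else 0 := by
  have heps := epsN_nonneg d γ N
  have hl : 0 ≤ znorm l := Real.sqrt_nonneg _
  have hk0 : 0 ≤ znorm k := Real.sqrt_nonneg _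
  split_ifs with h h' h'
  · have hpos := znorm_pos h.1
    have ht := thetaN_sq_le γ N h.1
    rw [if_pos h'] at ht
    rw [abs_mul, abs_mul, abs_sq]
    calc _ ≤ epsN d γ N * znorm k ^ (-(2 : ℝ) * γ) * 1 * (4 * znorm l / znorm k) := by
          gcongr
          · exact abs_sin2_le_one k l
          · exact abs_rdot_mul_rdot_div_sub_le ha hb h.1 h.2
      _ = 4 * znorm l * epsN d γ N * znorm k ^ (-(2 : ℝ) * γ - 1) := by
          rw [Real.rpow_sub_one hpos.ne']
          ring
  · have hN : ¬(1 ≤ znorm k ∧ znorm k ≤ N) := fun hc => h' ⟨h.1, hc.2⟩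
    simp [thetaN, if_neg hN]
  · rw [abs_zero]
    positivity
  · simp

/-- `|∑_{k ≠ 0, k ≠ l} (θ^N_k)² sin²(∠_{k,l}) ((a·(k-l))(b·(k-l))/|k-l|² - (a·k)(b·k)/|k|²)|
≤ 4|l| D_N`. -/
theorem stmt11 {d : ℕ} (hd : 2 ≤ d) (γ : ℝ) (hγ : 0 < γ ∧ γ < d / 2)
    (l : Fin d → ℤ) (hl : l ≠ 0) (a b : Fin d → ℝ)
    (ha : ∑ i, a i ^ 2 = 1) (hb : ∑ i, b i ^ 2 = 1) (N : ℕ) (hN : 1 ≤ N) :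
    |∑' k : Fin d → ℤ,
        if k ≠ 0 ∧ k ≠ l then
          thetaN d γ N k ^ 2 * sin2 k l *
            (rdot a (k - l) * rdot b (k - l) / znorm (k - l) ^ 2 -
              rdot a k * rdot b k / znorm k ^ 2)
        else 0| ≤ 4 * znorm l * DN d γ N := by
  rw [DN, ← mul_assoc, ← tsum_mul_left]
  have hsum : Summable fun k : Fin d → ℤ => 4 * znorm l * epsN d γ N *
      if k ≠ 0 ∧ znorm k ≤ N then znorm k ^ (-(2 : ℝ) * γ - 1) else 0 := by
    refine summable_of_hasFiniteSupport ((finite_setOf_znorm_le d N).subset fun k hk => ?_)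
    by_contra hN
    exact hk (mul_eq_zero_of_right _ (if_neg fun h => hN h.2))
  rw [← Real.norm_eq_abs]
  exact tsum_of_norm_bounded hsum.hasSum fun k => summand_abs_le γ N ha hb k l
end
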